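/- arXiv:2002.08814 — 8 statements merged into one kernel-verified Lean document; each statement's English description precedes it below -/
import Mathlib

section
/- Let n > 2 and q > 0 be integers such that n is even or q is odd. Then for any prime p with p > max{n, (q-1)n + 1}, the rational number ∑_{k=0}^{p-1} (q - p/n)_k^n / (1)_k^n is congruent to 0 modulo p^3, i.e., its p-adic valuation is at least 3. -/
section

open Finset Polynomial

/-- The binomial theorem, truncated after the quadratic term. -/
theorem pow_three_dvd_one_add_pow_sub {R : Type*} [CommRing R] (x : R) (n : ℕ) :
    x ^ 3 ∣ (1 + x) ^ n - (1 + n * x + n.choose 2 * x ^ 2) := by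
  induction n with
  | zero => simp
  | succ n ih =>
    obtain ⟨c, hc⟩ := ih
    refine ⟨c * (1 + x) + n.choose 2, ?_⟩
    have h : ((n + 1).choose 2 : R) = n + n.choose 2 := by
      rw [Nat.choose_succ_succ' n 1, Nat.choose_one_right, Nat.cast_add]
    rw [pow_succ, h]
    push_cast
    linear_combination (1 + x) * hc

theorem dvd_prod_one_sub_mul_sub_one {R ι : Type*} [CommRing R] (s : Finset ι) (π : R)
    (u : ι → R) : π ∣ ∏ j ∈ s, (1 - π * u j) - 1 := by
  classical
  induction s using Finset.induction_on with
  | empty => simp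
  | insert a s ha ih =>
    obtain ⟨g, hg⟩ := ih
    rw [prod_insert ha]
    exact ⟨g * (1 - π * u a) - u a, by linear_combination (1 - π * u a) * hg⟩

/-- If `ν` is inverse to `n`, then `∏ (1 - πνuⱼ) ^ n` agrees with `∏ (1 - πuⱼ)` modulo `π³` up to
a multiple of `π² ∑ uⱼ²`. -/
theorem pow_three_dvd_prod_pow_sub {R ι : Type*} [CommRing R] (s : Finset ι) (π ν : R)
    (u : ι → R) (n : ℕ) (hν : n * ν = 1) :
    π ^ 3 ∣ (∏ j ∈ s, (1 - π * ν * u j)) ^ n -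
      (∏ j ∈ s, (1 - π * u j) + n.choose 2 * ν ^ 2 * π ^ 2 * ∑ j ∈ s, u j ^ 2) := by
  classical
  induction s using Finset.induction_on with
  | empty => simp
  | insert a s ha ih =>
    obtain ⟨f, hf⟩ := ih
    obtain ⟨g, hg⟩ := dvd_prod_one_sub_mul_sub_one s π u
    obtain ⟨e, he⟩ := pow_three_dvd_one_add_pow_sub (-(π * ν * u a)) n
    rw [prod_insert ha, prod_insert ha, sum_insert ha, mul_pow]
    have he' : (1 - π * ν * u a) ^ n = 1 - π * u a + n.choose 2 * ν ^ 2 * π ^ 2 * u a ^ 2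
        - π ^ 3 * (ν * u a) ^ 3 * e := by
      linear_combination he - π * u a * hν
    have hf' := sub_eq_iff_eq_add.1 hf
    have hg' := sub_eq_iff_eq_add.1 hg
    rw [he', hf', hg']
    set H := ∑ j ∈ s, u j ^ 2
    set c : R := n.choose 2 * ν ^ 2
    refine ⟨(1 - π * u a + c * π ^ 2 * u a ^ 2 - π ^ 3 * (ν * u a) ^ 3 * e) * f
      - (ν * u a) ^ 3 * e * (π * g + 1 + c * π ^ 2 * H)
      + c * u a ^ 2 * (g + c * π * H) - c * u a * H, ?_⟩
    ring

/-- The alternating binomial sum of a polynomial of small degree vanishes. -/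
theorem sum_neg_one_pow_mul_choose_mul_eval {P : ℤ[X]} {N : ℕ} (hP : P.natDegree < N) :
    ∑ k ∈ range (N + 1), (-1) ^ k * (N.choose k : ℤ) * P.eval (k : ℤ) = 0 := by
  have h := congrFun (Polynomial.fwdDiff_iter_eq_zero_of_degree_lt hP) 0
  rw [fwdDiff_iter_eq_sum_shift] at h
  have h2 : ∑ k ∈ range (N + 1), (-1) ^ k * (N.choose k : ℤ) * P.eval (k : ℤ) =
      (-1) ^ N * ∑ k ∈ range (N + 1), ((-1 : ℤ) ^ (N - k) * N.choose k) • P.eval (0 + k • 1) := by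
    rw [mul_sum]
    refine sum_congr rfl fun k hk => ?_
    have hk' : k ≤ N := Nat.lt_succ_iff.1 (mem_range.1 hk)
    have : (-1 : ℤ) ^ N * (-1) ^ (N - k) = (-1) ^ k := by
      obtain ⟨d, rfl⟩ := Nat.exists_eq_add_of_le hk'
      rw [Nat.add_sub_cancel_left, pow_add, mul_assoc, ← mul_pow]
      simp
    rw [← this]
    simp [mul_assoc]
  rw [h2, h]
  simp

theorem natDegree_prod_X_add_C_le {R ι : Type*} [CommRing R] [Nontrivial R] (s : Finset ι)
    (a : ι → R) : (∏ i ∈ s, (X + C (a i))).natDegree ≤ #s := by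
  refine (natDegree_prod_le _ _).trans ?_
  simp

theorem prod_eq_factorial_mul_choose (m k : ℕ) :
    ∏ i ∈ range m, (k + 1 + i) = m.factorial * (m + k).choose k := by
  rw [← Nat.ascFactorial_eq_prod_range, Nat.ascFactorial_eq_factorial_mul_choose, add_comm k m,
    Nat.choose_symm_add]

theorem sum_neg_one_pow_mul_choose_mul_choose_pow {m n N : ℕ} (h : m * n < N) :
    ∑ k ∈ range (N + 1), (-1) ^ k * (N.choose k : ℤ) * ((m + k).choose k : ℤ) ^ n = 0 := by
  let P : ℤ[X] := (∏ i ∈ range m, (X + C (1 + i : ℤ))) ^ n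
  have hP : P.natDegree < N := by
    refine (natDegree_pow_le.trans ?_).trans_lt h
    rw [mul_comm]
    gcongr
    simpa using natDegree_prod_X_add_C_le (range m) fun i : ℕ => (1 + i : ℤ)
  have h0 := sum_neg_one_pow_mul_choose_mul_eval hP
  have he (k : ℕ) : P.eval (k : ℤ) = (m.factorial : ℤ) ^ n * ((m + k).choose k : ℤ) ^ n := by
    rw [← mul_pow, ← Nat.cast_mul, ← prod_eq_factorial_mul_choose]
    simp [P, eval_prod, add_assoc]
  refine (mul_eq_zero.1 (?_ : (m.factorial : ℤ) ^ n * _ = 0)).resolve_left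
    (pow_ne_zero _ (Nat.cast_ne_zero.2 m.factorial_ne_zero))
  rw [mul_sum, ← h0]
  refine sum_congr rfl fun k _ => ?_
  rw [he]
  ring

section ZMod

variable {p : ℕ} [Fact p.Prime]

theorem sum_range_natCast_zmod {M : Type*} [AddCommMonoid M] (f : ZMod p → M) :
    ∑ k ∈ range p, f k = ∑ x : ZMod p, f x := by
  refine sum_bij (fun k _ => (k : ZMod p)) (fun _ _ => mem_univ _) (fun a ha b hb hab => ?_)
    (fun x _ => ⟨x.val, mem_range.2 x.val_lt, by simp⟩) fun _ _ => rfl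
  rw [ZMod.natCast_eq_natCast_iff'] at hab
  rwa [Nat.mod_eq_of_lt (mem_range.1 ha), Nat.mod_eq_of_lt (mem_range.1 hb)] at hab

theorem sum_range_eval_zmod_eq_zero {P : (ZMod p)[X]} (hP : P.natDegree < p - 1) :
    ∑ k ∈ range p, P.eval (k : ZMod p) = 0 := by
  rw [sum_range_natCast_zmod fun x => P.eval x]
  simp_rw [eval_eq_sum_range]
  rw [sum_comm]
  refine sum_eq_zero fun i hi => ?_
  rw [← mul_sum, FiniteField.sum_pow_lt_card_sub_one, mul_zero]
  rw [ZMod.card]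
  exact (Nat.lt_succ_iff.1 (mem_range.1 hi)).trans_lt hP

theorem sum_range_inv_sq_zmod (hp : 5 ≤ p) : ∑ k ∈ range p, ((k : ZMod p)⁻¹) ^ 2 = 0 := by
  rw [sum_range_natCast_zmod fun x : ZMod p => x⁻¹ ^ 2]
  refine (Equiv.sum_comp (Equiv.inv (ZMod p)) fun x => x ^ 2).trans ?_
  apply FiniteField.sum_pow_lt_card_sub_one
  rw [ZMod.card]
  omega

/-- Reflection of the harmonic numbers of order two modulo `p`. -/
theorem sum_range_sub_inv_sq_zmod (hp : 5 ≤ p) {k : ℕ} (hk : k < p) :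
    ∑ i ∈ range (p - k), ((i : ZMod p)⁻¹) ^ 2 = -∑ i ∈ range (k + 1), ((i : ZMod p)⁻¹) ^ 2 := by
  have hadd := sum_range_add (fun i : ℕ => ((i : ZMod p)⁻¹) ^ 2) (p - k) k
  rw [Nat.sub_add_cancel hk.le] at hadd
  rw [eq_neg_iff_add_eq_zero, ← sum_range_inv_sq_zmod hp, sum_range_succ', hadd]
  simp only [Nat.cast_zero, inv_zero, zero_pow two_ne_zero, add_zero]
  congr 1
  rw [← sum_range_reflect]
  refine sum_congr rfl fun i hi => ?_
  have hi := mem_range.1 hi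
  have h : ((p - k + i : ℕ) : ZMod p) = -((k - 1 - i + 1 : ℕ) : ZMod p) := by
    rw [eq_neg_iff_add_eq_zero, ← Nat.cast_add, show p - k + i + (k - 1 - i + 1) = p by omega,
      ZMod.natCast_self]
  rw [h, inv_neg, neg_sq]

variable {m n : ℕ}

theorem sum_range_prod_pow_zmod (h : m * n + 1 < p) :
    ∑ k ∈ range p, (∏ i ∈ range m, ((k : ZMod p) + (1 + i))) ^ n = 0 := by
  let P : (ZMod p)[X] := (∏ i ∈ range m, (X + C (1 + i : ZMod p))) ^ n
  have hP : P.natDegree < p - 1 := by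
    refine (natDegree_pow_le.trans ?_).trans_lt (Nat.lt_sub_of_add_lt h)
    rw [mul_comm]
    gcongr
    simpa using natDegree_prod_X_add_C_le (range m) fun i : ℕ => (1 + i : ZMod p)
  simpa [P, eval_prod] using sum_range_eval_zmod_eq_zero hP

theorem sum_range_prod_pow_mul_inv_sq_zmod (hn : 2 < n) (h : m * n + 1 < p) {j : ℕ} (hj : j < m) :
    ∑ k ∈ range p, (∏ i ∈ range m, ((k : ZMod p) + (1 + i))) ^ n *
      (((k + 1 + j : ℕ) : ZMod p)⁻¹) ^ 2 = 0 := by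
  let P : (ZMod p)[X] := (∏ i ∈ (range m).erase j, (X + C (1 + i : ZMod p))) ^ n *
    (X + C (1 + j : ZMod p)) ^ (n - 2)
  have hP : P.natDegree < p - 1 := by
    refine (natDegree_mul_le.trans (add_le_add natDegree_pow_le natDegree_pow_le)).trans_lt ?_
    have h1 := natDegree_prod_X_add_C_le ((range m).erase j) fun i : ℕ => (1 + i : ZMod p)
    rw [card_erase_of_mem (mem_range.2 hj), card_range] at h1
    have h2 := Nat.mul_le_mul_left n h1
    rw [natDegree_X_add_C]
    obtain ⟨m, rfl⟩ : ∃ l, m = l + 1 := ⟨m - 1, by omega⟩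
    rw [Nat.add_sub_cancel] at h2
    have h3 : (m + 1) * n = n * m + n := by ring
    omega
  rw [← sum_range_eval_zmod_eq_zero hP]
  refine sum_congr rfl fun k _ => ?_
  rw [← mul_prod_erase _ _ (mem_range.2 hj), mul_pow]
  simp only [P, eval_prod, eval_mul, eval_pow, eval_add, eval_X, eval_C]
  have hc : ((k + 1 + j : ℕ) : ZMod p) = k + (1 + j) := by push_cast; ring
  rw [hc]
  have hx (x : ZMod p) : x ^ n * x⁻¹ ^ 2 = x ^ (n - 2) := by
    by_cases hx : x = 0
    · rw [hx, zero_pow (by omega), zero_pow (by omega), zero_mul]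
    · rw [inv_pow, pow_sub₀ x hx (by omega)]
  rw [mul_right_comm, hx, mul_comm]

theorem prod_reflect_zmod (k k' : ℕ) (h : k + k' + m + 1 = p) :
    ∏ i ∈ range m, ((k' : ZMod p) + (1 + i)) =
      (-1) ^ m * ∏ i ∈ range m, ((k : ZMod p) + (1 + i)) := by
  rw [← prod_range_reflect, ← card_range m, ← prod_const, card_range, ← prod_mul_distrib]
  refine prod_congr rfl fun i hi => ?_
  have hi := mem_range.1 hi
  have : ((k + k' + m + 1 : ℕ) : ZMod p) = 0 := by rw [h, ZMod.natCast_self]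
  have h2 : ((m - 1 - i : ℕ) : ZMod p) = m - 1 - i := by
    rw [Nat.cast_sub (by omega), Nat.cast_sub (by omega), Nat.cast_one]
  push_cast at this
  rw [h2]
  linear_combination this

theorem prod_zmod_eq_zero {k : ℕ} (h1 : p ≤ k + m) (h2 : k < p) :
    ∏ i ∈ range m, ((k : ZMod p) + (1 + i)) = 0 := by
  refine prod_eq_zero (mem_range.2 (by omega : p - 1 - k < m)) ?_
  rw [← Nat.cast_one, ← Nat.cast_add, ← Nat.cast_add, show k + (1 + (p - 1 - k)) = p by omega,
    ZMod.natCast_self]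

theorem sum_range_sub_eq_sum_range_zmod (hn : n ≠ 0) (g : ℕ → ZMod p) :
    ∑ k ∈ range (p - m), (∏ i ∈ range m, ((k : ZMod p) + (1 + i))) ^ n * g k =
      ∑ k ∈ range p, (∏ i ∈ range m, ((k : ZMod p) + (1 + i))) ^ n * g k := by
  refine sum_subset (range_mono (Nat.sub_le _ _)) fun k hk hk' => ?_
  rw [mem_range] at hk hk'
  rw [prod_zmod_eq_zero (by omega) hk, zero_pow hn, zero_mul]

theorem sum_range_prod_pow_mul_sum_inv_sq_zmod (hp : 5 ≤ p) (hn : 2 < n) (h : m * n + 1 < p)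
    (hpar : Even n ∨ Even m) :
    ∑ k ∈ range (p - m), (∏ i ∈ range m, ((k : ZMod p) + (1 + i))) ^ n *
      ∑ j ∈ range k, (((m + 1 + j : ℕ) : ZMod p)⁻¹) ^ 2 = 0 := by
  let w (k : ℕ) : ZMod p := (∏ i ∈ range m, ((k : ZMod p) + (1 + i))) ^ n
  let H (k : ℕ) : ZMod p := ∑ i ∈ range k, ((i : ZMod p)⁻¹) ^ 2
  have hadd (a b : ℕ) : ∑ i ∈ range b, (((a + i : ℕ) : ZMod p)⁻¹) ^ 2 = H (a + b) - H a := by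
    simp only [H]
    rw [sum_range_add, add_sub_cancel_left]
  have hm : m < p := by nlinarith
  simp only [hadd]
  change ∑ k ∈ range (p - m), w k * (H (m + 1 + k) - H (m + 1)) = 0
  have hrefl : ∑ k ∈ range (p - m), w k * (H (m + 1 + k) - H (m + 1)) =
      ∑ k ∈ range (p - m), w k * (-H (k + 1) - H (m + 1)) := by
    rw [← sum_range_reflect]
    refine sum_congr rfl fun k hk => ?_
    have hk := mem_range.1 hk
    have hw : w (p - m - 1 - k) = w k := by
      simp only [w]
      rw [prod_reflect_zmod k (p - m - 1 - k) (by omega), mul_pow, ← pow_mul,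
        (Nat.even_mul.2 hpar.symm).neg_one_pow, one_mul]
    rw [hw, show m + 1 + (p - m - 1 - k) = p - k by omega]
    simp only [H]
    rw [sum_range_sub_inv_sq_zmod hp (by omega)]
  have h2 : (2 : ZMod p) * ∑ k ∈ range (p - m), w k * (H (m + 1 + k) - H (m + 1)) = 0 := by
    rw [two_mul]
    nth_rewrite 2 [hrefl]
    rw [← sum_add_distrib]
    have : ∀ k, w k * (H (m + 1 + k) - H (m + 1)) + w k * (-H (k + 1) - H (m + 1)) =
        w k * (∑ j ∈ range m, (((k + 1 + j : ℕ) : ZMod p)⁻¹) ^ 2 - 2 * H (m + 1)) := by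
      intro k
      rw [hadd, show k + 1 + m = m + 1 + k by omega]
      ring
    simp only [this]
    rw [sum_range_sub_eq_sum_range_zmod (by omega)]
    simp only [mul_sub, mul_sum, sum_sub_distrib]
    rw [sum_comm, ← sum_mul, sum_range_prod_pow_zmod h, zero_mul, sub_zero]
    exact sum_eq_zero fun j hj => sum_range_prod_pow_mul_inv_sq_zmod hn h (mem_range.1 hj)
  refine (mul_eq_zero.1 h2).resolve_left fun h0 => ?_
  have := (ZMod.natCast_eq_zero_iff 2 p).1 (by exact_mod_cast h0)
  exact absurd (Nat.le_of_dvd two_pos this) (by omega)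

end ZMod

namespace PadicInt

variable {p : ℕ} [Fact p.Prime] {m n : ℕ}

theorem natCast_mul_inverse {a : ℕ} (ha : ¬ p ∣ a) :
    (a : ℤ_[p]) * Ring.inverse (a : ℤ_[p]) = 1 := by
  refine Ring.mul_inverse_cancel _ (isUnit_iff.2 (norm_natCast_eq_one_iff.2 ?_))
  exact (Nat.Prime.coprime_iff_not_dvd Fact.out).2 ha

theorem natCast_mul_inverse_of_lt {a : ℕ} (h0 : 0 < a) (ha : a < p) :
    (a : ℤ_[p]) * Ring.inverse (a : ℤ_[p]) = 1 :=
  natCast_mul_inverse (Nat.not_dvd_of_pos_of_lt h0 ha)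

theorem natCast_factorial_mul_inverse {k : ℕ} (hk : k < p) :
    (k.factorial : ℤ_[p]) * Ring.inverse (k.factorial : ℤ_[p]) = 1 :=
  natCast_mul_inverse fun h => hk.not_ge ((Nat.Prime.dvd_factorial Fact.out).1 h)

theorem coe_inverse_natCast {a : ℕ} (ha : ¬ p ∣ a) :
    ((Ring.inverse (a : ℤ_[p]) : ℤ_[p]) : ℚ_[p]) = (a : ℚ_[p])⁻¹ := by
  refine eq_inv_of_mul_eq_one_right ?_
  have := congrArg ((↑) : ℤ_[p] → ℚ_[p]) (natCast_mul_inverse ha)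
  simpa using this

theorem toZMod_inverse_natCast {a : ℕ} (ha : ¬ p ∣ a) :
    toZMod (Ring.inverse (a : ℤ_[p])) = (a : ZMod p)⁻¹ := by
  refine eq_inv_of_mul_eq_one_right ?_
  have := congrArg (toZMod (p := p)) (natCast_mul_inverse ha)
  simpa using this

theorem natCast_dvd_of_toZMod_eq_zero {x : ℤ_[p]} (hx : toZMod x = 0) : (p : ℤ_[p]) ∣ x := by
  rw [← Ideal.mem_span_singleton, ← maximalIdeal_eq_span_p, ← ker_toZMod]
  exact hx

theorem prod_natCast_sub_mul {k : ℕ} (hk : k + m < p) (x : ℤ_[p]) :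
    ∏ j ∈ range k, (((m + 1 + j : ℕ) : ℤ_[p]) - x) =
      k.factorial * (m + k).choose k *
        ∏ j ∈ range k, (1 - x * Ring.inverse ((m + 1 + j : ℕ) : ℤ_[p])) := by
  rw [← Nat.cast_mul, ← Nat.ascFactorial_eq_factorial_mul_choose, Nat.ascFactorial_eq_prod_range,
    Nat.cast_prod, ← prod_mul_distrib]
  refine prod_congr rfl fun j hj => ?_
  have hj := mem_range.1 hj
  have := natCast_mul_inverse_of_lt (p := p) (a := m + 1 + j) (by omega) (by omega)
  linear_combination x * this

theorem choose_mul_prod_one_sub {k : ℕ} (hk : k + m < p) :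
    ((m + k).choose k : ℤ_[p]) *
      ∏ j ∈ range k, (1 - p * Ring.inverse ((m + 1 + j : ℕ) : ℤ_[p])) =
      (-1) ^ k * (p - m - 1).choose k := by
  refine mul_left_cancel₀ (Nat.cast_ne_zero.2 k.factorial_ne_zero : (k.factorial : ℤ_[p]) ≠ 0) ?_
  rw [← mul_assoc, ← prod_natCast_sub_mul hk, mul_left_comm, ← Nat.cast_mul,
    ← Nat.descFactorial_eq_factorial_mul_choose, Nat.descFactorial_eq_prod_range, Nat.cast_prod,
    ← card_range k, ← prod_const, card_range, ← prod_mul_distrib]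
  refine prod_congr rfl fun j hj => ?_
  have hj := mem_range.1 hj
  rw [Nat.sub_sub, Nat.sub_sub, Nat.cast_sub (by omega), ← add_assoc]
  ring

theorem sum_choose_pow_mul_prod_one_sub (hn : 0 < n) (h : m * n + 1 < p) :
    ∑ k ∈ range (p - m), ((m + k).choose k : ℤ_[p]) ^ n *
      ∏ j ∈ range k, (1 - p * Ring.inverse ((m + 1 + j : ℕ) : ℤ_[p])) = 0 := by
  obtain ⟨n, rfl⟩ : ∃ l, n = l + 1 := ⟨n - 1, by omega⟩
  have hm : m * n + m + 1 < p := by linarith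
  have h0 := congrArg (Int.cast (R := ℤ_[p]))
    (sum_neg_one_pow_mul_choose_mul_choose_pow (m := m) (n := n) (N := p - m - 1) (by omega))
  rw [Nat.sub_add_cancel (by omega : 1 ≤ p - m)] at h0
  push_cast at h0
  rw [← h0]
  refine sum_congr rfl fun k hk => ?_
  have hk := mem_range.1 hk
  rw [← choose_mul_prod_one_sub (by omega)]
  ring

theorem dvd_sum_choose_pow_mul_sum_inverse_sq (hp : 5 ≤ p) (hn : 2 < n) (h : m * n + 1 < p)
    (hpar : Even n ∨ Even m) :
    (p : ℤ_[p]) ∣ ∑ k ∈ range (p - m), ((m + k).choose k : ℤ_[p]) ^ n *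
      ∑ j ∈ range k, Ring.inverse ((m + 1 + j : ℕ) : ℤ_[p]) ^ 2 := by
  apply natCast_dvd_of_toZMod_eq_zero
  have hm : m < p := by nlinarith
  have hfac : (m.factorial : ZMod p) ≠ 0 := fun h0 =>
    hm.not_ge ((Nat.Prime.dvd_factorial Fact.out).1 ((ZMod.natCast_eq_zero_iff _ _).1 h0))
  refine (mul_eq_zero.1 (?_ : (m.factorial : ZMod p) ^ n * _ = 0)).resolve_left
    (pow_ne_zero _ hfac)
  rw [← sum_range_prod_pow_mul_sum_inv_sq_zmod hp hn h hpar, map_sum, mul_sum]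
  refine sum_congr rfl fun k hk => ?_
  have hk := mem_range.1 hk
  rw [map_mul, map_pow, map_natCast, map_sum, ← mul_assoc, ← mul_pow, ← Nat.cast_mul,
    ← prod_eq_factorial_mul_choose]
  congr 1
  · simp [add_assoc]
  · refine sum_congr rfl fun j hj => ?_
    have hj := mem_range.1 hj
    rw [map_pow, toZMod_inverse_natCast (Nat.not_dvd_of_pos_of_lt (by omega) (by omega))]

theorem pow_three_dvd_sum (hn : 2 < n) (hnp : n < p) (h : m * n + 1 < p)
    (hpar : Even n ∨ Even m) :
    (p : ℤ_[p]) ^ 3 ∣ ∑ k ∈ range p,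
      ((∏ j ∈ range k, (((m + 1 + j : ℕ) : ℤ_[p]) - p * Ring.inverse (n : ℤ_[p]))) *
        Ring.inverse (k.factorial : ℤ_[p])) ^ n := by
  have hprime : p.Prime := Fact.out
  have hp : 5 ≤ p := by
    have : p ≠ 4 := by rintro rfl; exact absurd hprime (by decide)
    omega
  have hm : m < p := by nlinarith
  rw [← sum_range_add_sum_Ico _ (Nat.sub_le p m)]
  refine dvd_add ?_ (dvd_sum fun k hk => ?_)
  · have hmain : ∀ k ∈ range (p - m), (p : ℤ_[p]) ^ 3 ∣
        ((∏ j ∈ range k, (((m + 1 + j : ℕ) : ℤ_[p]) - p * Ring.inverse (n : ℤ_[p]))) *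
          Ring.inverse (k.factorial : ℤ_[p])) ^ n -
        (((m + k).choose k : ℤ_[p]) ^ n *
          ∏ j ∈ range k, (1 - p * Ring.inverse ((m + 1 + j : ℕ) : ℤ_[p])) +
          n.choose 2 * Ring.inverse (n : ℤ_[p]) ^ 2 * p ^ 2 * (((m + k).choose k : ℤ_[p]) ^ n *
          ∑ j ∈ range k, Ring.inverse ((m + 1 + j : ℕ) : ℤ_[p]) ^ 2)) := by
      intro k hk
      have hk := mem_range.1 hk
      obtain ⟨c, hc⟩ := pow_three_dvd_prod_pow_sub (range k) (p : ℤ_[p])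
        (Ring.inverse (n : ℤ_[p])) (fun j => Ring.inverse ((m + 1 + j : ℕ) : ℤ_[p])) n
        (natCast_mul_inverse_of_lt (by omega) hnp)
      refine ⟨((m + k).choose k : ℤ_[p]) ^ n * c, ?_⟩
      rw [prod_natCast_sub_mul (by omega)]
      have hfac := natCast_factorial_mul_inverse (p := p) (k := k) (by omega)
      rw [mul_right_comm, mul_right_comm (k.factorial : ℤ_[p]), hfac, one_mul, mul_pow]
      linear_combination ((m + k).choose k : ℤ_[p]) ^ n * hc
    have hsum := dvd_sum hmain
    rw [sum_sub_distrib, sum_add_distrib, ← mul_sum,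
      sum_choose_pow_mul_prod_one_sub (by omega) h, zero_add] at hsum
    refine (dvd_iff_dvd_of_dvd_sub hsum).2 ?_
    rw [mul_assoc, pow_succ]
    exact dvd_mul_of_dvd_right
      (mul_dvd_mul_left _ (dvd_sum_choose_pow_mul_sum_inverse_sq hp hn h hpar)) _
  · have hk := mem_Ico.1 hk
    refine (pow_dvd_pow _ hn).trans (pow_dvd_pow_of_dvd (dvd_mul_of_dvd_left ?_ _) n)
    refine Dvd.dvd.trans ?_ (dvd_prod_of_mem _ (mem_range.2 (by omega : p - m - 1 < k)))
    rw [show m + 1 + (p - m - 1) = p by omega]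
    exact dvd_sub dvd_rfl (dvd_mul_right _ _)

end PadicInt

theorem ascPochhammer_eval_eq_prod_range_add {S : Type*} [CommSemiring S] (k : ℕ) (x : S) :
    (ascPochhammer S k).eval x = ∏ j ∈ range k, (x + j) := by
  induction k with
  | zero => simp
  | succ k ih => rw [ascPochhammer_succ_eval, ih, prod_range_succ]

theorem Rat.exists_eq_natCast_pow_mul_div {p : ℕ} [Fact p.Prime] {r : ℚ} {e : ℕ} {x : ℤ_[p]}
    (hr : (r : ℚ_[p]) = (p ^ e * x : ℤ_[p])) :
    ∃ a b : ℤ, ¬ ((p : ℤ) ∣ b) ∧ r = (p : ℚ) ^ e * a / b := by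
  have hp0 : (p : ℚ) ≠ 0 := Nat.cast_ne_zero.2 (NeZero.ne p)
  have hx : ((r / p ^ e : ℚ) : ℚ_[p]) = x := by
    have : (p : ℚ_[p]) ≠ 0 := Nat.cast_ne_zero.2 (NeZero.ne p)
    push_cast at hr ⊢
    rw [hr]
    field_simp
  refine ⟨(r / p ^ e).num, (r / p ^ e).den, fun hdvd => ?_, ?_⟩
  · have hu := PadicInt.isUnit_den (p := p) (r / p ^ e) (by rw [hx]; exact x.2)
    rw [PadicInt.isUnit_iff, PadicInt.norm_natCast_eq_one_iff,
      Nat.Prime.coprime_iff_not_dvd Fact.out] at hu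
    exact hu (Int.natCast_dvd_natCast.1 hdvd)
  · rw [mul_div_assoc, Int.cast_natCast, Rat.num_div_den]
    field_simp

end

/-- For integers `n > 2` and `q > 0` with `n` even or `q` odd, and any prime
`p > max {n, (q-1)n+1}`, the rational number `∑_{k=0}^{p-1} (q - p/n)_k^n / (1)_k^n`
is congruent to `0` modulo `p^3`, i.e. it can be written as `p^3 * a / b` with `p ∤ b`. -/
theorem stmt_0 (n q : ℕ) (hn : 2 < n) (hq : 0 < q) (hpar : Even n ∨ Odd q)
    (p : ℕ) (hp : p.Prime) (hgt : p > max n ((q - 1) * n + 1)) :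
    ∃ a b : ℤ, ¬ ((p : ℤ) ∣ b) ∧
      ∑ k ∈ Finset.range p,
          ((ascPochhammer ℚ k).eval ((q : ℚ) - (p : ℚ) / (n : ℚ))) ^ n /
            ((ascPochhammer ℚ k).eval 1) ^ n
        = (p : ℚ) ^ 3 * a / b := by
  have hnp : n < p := (le_max_left _ _).trans_lt hgt
  have hmp : (q - 1) * n + 1 < p := (le_max_right _ _).trans_lt hgt
  obtain ⟨m, rfl⟩ : ∃ m, q = m + 1 := ⟨q - 1, by omega⟩
  rw [Nat.add_sub_cancel] at hmp
  have : Fact p.Prime := ⟨hp⟩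
  have hpar' : Even n ∨ Even m := hpar.imp_right fun h => by simpa [Nat.odd_add_one] using h
  obtain ⟨x, hx⟩ := PadicInt.pow_three_dvd_sum (p := p) hn hnp hmp hpar'
  refine Rat.exists_eq_natCast_pow_mul_div (x := x) ?_
  rw [← hx, PadicInt.coe_sum, Rat.cast_sum]
  refine Finset.sum_congr rfl fun k hk => ?_
  have hk := Finset.mem_range.1 hk
  rw [ascPochhammer_eval_one, ascPochhammer_eval_eq_prod_range_add, ← div_pow, Rat.cast_pow,
    PadicInt.coe_pow, PadicInt.coe_mul,
    PadicInt.coe_inverse_natCast fun h => hk.not_ge (hp.dvd_factorial.1 h), Rat.cast_div,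
    Rat.cast_natCast, div_eq_mul_inv, Rat.cast_prod]
  congr 2
  refine Eq.trans (Finset.prod_congr rfl fun j _ => ?_) (map_prod PadicInt.Coe.ringHom _ _).symm
  change _ = ((_ : ℤ_[p]) : ℚ_[p])
  rw [PadicInt.coe_sub, PadicInt.coe_mul,
    PadicInt.coe_inverse_natCast (Nat.not_dvd_of_pos_of_lt (by omega) hnp)]
  push_cast
  ring
end

section
/- Let n > 2 and q > 0 be integers such that n is even or q is odd. Then for any prime p with p > max{n, (q-1)n + 1}, the rational number p^n · ∑_{k=0}^{p-1} (1)_k^n / (p/n - q + 2)_k^n is congruent to 0 modulo p^3, i.e., its p-adic valuation is at least 3. (Note that since p is a prime greater than n, p/n is not an integer, so each factor p/n - q + 2 + i is nonzero and each Pochhammer value (p/n - q + 2)_k is a nonzero rational.) -/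
open Finset Polynomial

/-- The truncated binomial expansion of `(1 + x) ^ n` modulo `x ^ 3`. -/
theorem exists_one_add_pow_eq {R : Type*} [CommRing R] (x : R) (n : ℕ) :
    ∃ r, (1 + x) ^ n = 1 + n * x + n.choose 2 * x ^ 2 + x ^ 3 * r := by
  induction n with
  | zero => exact ⟨0, by simp⟩
  | succ n ih =>
    obtain ⟨r, hr⟩ := ih
    refine ⟨n.choose 2 + r * (1 + x), ?_⟩
    rw [pow_succ, hr, Nat.choose_succ_succ' n 1, Nat.choose_one_right]
    push_cast
    ring

/-- The truncated expansion of `(1 + x) ^ (-n)` modulo `x ^ 3`. -/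
theorem exists_eq_of_mul_one_add_pow_eq_one {R : Type*} [CommRing R] {x y : R} {n : ℕ}
    (h : y * (1 + x) ^ n = 1) :
    ∃ t, y = 1 - n * x + (n + 1).choose 2 * x ^ 2 + x ^ 3 * t := by
  obtain ⟨r, hr⟩ := exists_one_add_pow_eq x n
  have hc : (n : R) ^ 2 = 2 * n.choose 2 + n := by
    have : n ^ 2 = 2 * n.choose 2 + n := by
      rw [Nat.choose_two_right, Nat.mul_div_cancel' (Nat.even_mul_pred_self n).two_dvd]
      cases n <;> simp
      ring
    simpa using congrArg (Nat.cast : ℕ → R) this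
  rw [hr] at h
  rw [Nat.choose_succ_succ' n 1, Nat.choose_one_right]
  push_cast
  set a : R := ((n.choose 2 : ℕ) : R)
  set N : R := ((n : ℕ) : R)
  refine ⟨-y * (-N * a + (a + N) * N + (a + N) * a * x
    + r * (1 - N * x + (a + N) * x ^ 2)), ?_⟩
  linear_combination (1 - N * x + (a + N) * x ^ 2) * h + y * x ^ 2 * hc

/-- Modulo `c ^ 3`, a product of the factors `(1 + c v i) ^ (-n)` is a product of linear factors
up to a multiple of a power sum. -/
theorem exists_prod_eq_prod_add_sum {R : Type*} [CommRing R] {c : R} {n N : ℕ} {v y : ℕ → R}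
    (h : ∀ i < N, y i * (1 + c * v i) ^ n = 1) :
    ∀ j ≤ N, ∃ r, ∏ i ∈ range j, y i = ∏ i ∈ range j, (1 - n * c * v i)
      + (n + 1).choose 2 * c ^ 2 * ∑ i ∈ range j, v i ^ 2 + c ^ 3 * r := by
  intro j hj
  suffices H : ∃ r s, ∏ i ∈ range j, y i = ∏ i ∈ range j, (1 - n * c * v i)
      + (n + 1).choose 2 * c ^ 2 * ∑ i ∈ range j, v i ^ 2 + c ^ 3 * r ∧
      ∏ i ∈ range j, (1 - n * c * v i) = 1 + c * s from
    H.imp fun r ⟨_, hr, _⟩ => hr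
  induction j with
  | zero => exact ⟨0, 0, by simp, by simp⟩
  | succ j ih =>
    obtain ⟨r, s, hr, hs⟩ := ih (by omega)
    obtain ⟨t, ht⟩ := exists_eq_of_mul_one_add_pow_eq_one (h j (by omega))
    simp only [prod_range_succ, sum_range_succ]
    set A := ∏ i ∈ range j, y i
    set B := ∏ i ∈ range j, (1 - n * c * v i)
    set H := ∑ i ∈ range j, v i ^ 2
    set K : R := ((n + 1).choose 2 : R)
    refine ⟨-K * H * n * v j + r * (1 - n * c * v j)
      + K * v j ^ 2 * (s + K * c * H + c ^ 2 * r) + A * v j ^ 3 * t,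
      s - n * v j * (1 + c * s), ?_, by rw [hs]; ring⟩
    linear_combination A * ht + (1 - n * c * v j + K * c ^ 2 * v j ^ 2) * hr
      + K * c ^ 2 * v j ^ 2 * hs

theorem prod_one_sub_eq_choose {R : Type*} [CommRing R] {p : ℕ} {v : ℕ → R}
    (hv : ∀ i < p - 1, ((i : R) + 1) * v i = 1) :
    ∀ j ≤ p - 1, ∏ i ∈ range j, (1 - p * v i) = (-1) ^ j * ((p - 1).choose j : R) := by
  intro j hj
  induction j with
  | zero => simp
  | succ j ih =>
    rw [prod_range_succ, ih (by omega)]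
    have h1 := hv j (by omega)
    have h2 : ((p - 1).choose (j + 1) : R) * (j + 1) = (p - 1).choose j * (p - 1 - j) := by
      have := congrArg (Nat.cast : ℕ → R) (Nat.choose_succ_right_eq (p - 1) j)
      rw [Nat.sub_sub] at this
      push_cast [Nat.cast_sub (show 1 + j ≤ p by omega)] at this
      rw [this]
      ring
    rw [pow_succ]
    linear_combination (-1) ^ j * (v j * h2 - ((p - 1).choose j + (p - 1).choose (j + 1) : R) * h1)

theorem sum_eval_mul_choose_eq_zero {R : Type*} [CommRing R] {P : R[X]} {n : ℕ}
    (hP : P.natDegree < n) :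
    ∑ j ∈ range (n + 1), P.eval (j : R) * ((-1) ^ j * (n.choose j : R)) = 0 := by
  have h := congrFun (Polynomial.fwdDiff_iter_eq_zero_of_degree_lt hP) 0
  rw [fwdDiff_iter_eq_sum_shift, Pi.zero_apply] at h
  have h2 : (-1 : R) ^ n *
      ∑ j ∈ range (n + 1), P.eval (j : R) * ((-1) ^ j * (n.choose j : R)) = 0 := by
    rw [← h, mul_sum]
    refine sum_congr rfl fun k hk => ?_
    have hk : k ≤ n := by simpa [Nat.lt_succ_iff] using hk
    simp only [zero_add, nsmul_eq_mul, mul_one, zsmul_eq_mul]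
    push_cast
    obtain ⟨d, rfl⟩ := Nat.exists_eq_add_of_le hk
    have : (-1 : R) ^ k * (-1) ^ k = 1 := by rw [← mul_pow]; simp
    rw [Nat.add_sub_cancel_left, pow_add]
    linear_combination (-1) ^ d * P.eval (k : R) * ((k + d).choose k : R) * this
  have h3 : (-1 : R) ^ n * (-1) ^ n = 1 := by rw [← mul_pow]; simp
  linear_combination (-1) ^ n * h2
    - (∑ j ∈ range (n + 1), P.eval (j : R) * ((-1) ^ j * (n.choose j : R))) * h3

/-- The polynomial `(X + 1) (X + 2) ⋯ (X + m)`. -/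
noncomputable def shiftedRising (R : Type*) [CommRing R] (m : ℕ) : R[X] :=
  ∏ i ∈ range m, (X + C ((i : R) + 1))

theorem shiftedRising_eval {R : Type*} [CommRing R] (m : ℕ) (x : R) :
    (shiftedRising R m).eval x = ∏ i ∈ range m, (x + (i + 1)) := by
  simp [shiftedRising, eval_prod]

theorem natDegree_shiftedRising_le {R : Type*} [CommRing R] (m : ℕ) :
    (shiftedRising R m).natDegree ≤ m := by
  nontriviality R
  refine (natDegree_prod_le _ _).trans ?_
  simp only [natDegree_X_add_C, sum_const, card_range, smul_eq_mul, mul_one, le_refl]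

theorem sum_natCast_zmod {p : ℕ} [NeZero p] {M : Type*} [AddCommMonoid M] (F : ZMod p → M) :
    ∑ j ∈ range p, F (j : ZMod p) = ∑ x, F x := by
  refine sum_nbij' (fun j => (j : ZMod p)) ZMod.val (by simp) ?_ ?_ (by simp) (by simp)
  · intro x _; simpa using ZMod.val_lt x
  · intro j hj; exact ZMod.val_cast_of_lt (by simpa using hj)

theorem sum_eval_eq_zero_of_natDegree_lt {K : Type*} [Field K] [Fintype K] {P : K[X]}
    (hP : P.natDegree < Fintype.card K - 1) : ∑ x : K, P.eval x = 0 := by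
  simp_rw [eval_eq_sum_range]
  rw [sum_comm]
  refine sum_eq_zero fun i hi => ?_
  rw [← mul_sum, FiniteField.sum_pow_lt_card_sub_one, mul_zero]
  have := mem_range.1 hi
  omega

theorem sum_range_inv_sq_eq_zero {p : ℕ} [Fact p.Prime] (hp : 3 < p) :
    ∑ i ∈ range (p - 1), ((i + 1 : ZMod p)⁻¹) ^ 2 = 0 := by
  have h1 := sum_natCast_zmod (fun x : ZMod p => (x⁻¹) ^ 2)
  obtain ⟨k, rfl⟩ : ∃ k, p = k + 1 := ⟨p - 1, by omega⟩
  rw [sum_range_succ'] at h1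
  have h2 : ∑ x : ZMod (k + 1), (x⁻¹) ^ 2 = ∑ x : ZMod (k + 1), x ^ 2 :=
    Fintype.sum_equiv (Equiv.inv (ZMod (k + 1))) _ _ (by simp)
  rw [h2, FiniteField.sum_pow_lt_card_sub_one _ _ (by rw [ZMod.card]; omega)] at h1
  simpa using h1

/-- The harmonic sum of order two, as a function on residue classes. -/
def zmodHarmonic (p : ℕ) (x : ZMod p) : ZMod p :=
  ∑ i ∈ range x.val, ((i + 1 : ZMod p)⁻¹) ^ 2

theorem zmodHarmonic_add_one {p : ℕ} [Fact p.Prime] (hp : 3 < p) (x : ZMod p) :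
    zmodHarmonic p (x + 1) = zmodHarmonic p x + ((x + 1)⁻¹) ^ 2 := by
  have hval : ((x.val : ℕ) : ZMod p) = x := by simp
  rcases lt_or_eq_of_le (Nat.succ_le_of_lt (ZMod.val_lt x)) with h | h
  · have : (x + 1).val = x.val + 1 := by
      conv_lhs => rw [← hval, ← Nat.cast_succ, ZMod.val_cast_of_lt h]
    rw [zmodHarmonic, this, sum_range_succ, hval, zmodHarmonic]
  · have h0 : x + 1 = 0 := by
      rw [← hval, ← Nat.cast_succ, h, ZMod.natCast_self]
    have hx : x.val = p - 1 := by omega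
    rw [h0, zmodHarmonic, zmodHarmonic, hx, sum_range_inv_sq_eq_zero hp]
    simp

theorem zmodHarmonic_neg {p : ℕ} [Fact p.Prime] (hp : 3 < p) (x : ZMod p) :
    zmodHarmonic p (-1 - x) = -zmodHarmonic p x := by
  have hN : ∀ k : ℕ, zmodHarmonic p (-1 - k) = -zmodHarmonic p k := by
    intro k
    induction k with
    | zero =>
      have := zmodHarmonic_add_one hp (-1)
      simpa [zmodHarmonic, eq_comm] using this
    | succ k ih =>
      have h1 := zmodHarmonic_add_one hp k
      have h2 := zmodHarmonic_add_one hp (-1 - (k + 1 : ZMod p))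
      have h3 : (-1 - (k + 1 : ZMod p)) + 1 = -1 - k := by ring
      have h4 : (-1 - k : ZMod p) = -(k + 1) := by ring
      rw [h3, ih, h4, inv_neg, neg_sq] at h2
      push_cast
      linear_combination -h2 + h1
  simpa using hN x.val

theorem zmodHarmonic_add_natCast {p : ℕ} [Fact p.Prime] (hp : 3 < p) (x : ZMod p) (m : ℕ) :
    zmodHarmonic p (x + m) = zmodHarmonic p x + ∑ i ∈ range m, ((x + (i + 1))⁻¹) ^ 2 := by
  induction m with
  | zero => simp
  | succ m ih =>
    rw [sum_range_succ, ← add_assoc, ← ih, Nat.cast_succ, ← add_assoc, zmodHarmonic_add_one hp]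

theorem shiftedRising_eval_reflect {R : Type*} [CommRing R] (m : ℕ) (x : R) :
    (shiftedRising R m).eval (-1 - m - x) = (-1) ^ m * (shiftedRising R m).eval x := by
  rw [shiftedRising_eval, shiftedRising_eval, ← prod_range_reflect]
  have : (-1 : R) ^ m = ∏ i ∈ range m, (-1) := by simp
  rw [this, ← prod_mul_distrib]
  refine prod_congr rfl fun i hi => ?_
  have := mem_range.1 hi
  rw [Nat.sub_sub, Nat.cast_sub (by omega)]
  push_cast
  ring

theorem sum_shiftedRising_pow_mul_inv_sq {p : ℕ} [Fact p.Prime] {m n i : ℕ} (hn : 2 < n)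
    (hi : i < m) (hmn : m * n + 1 < p) :
    ∑ x : ZMod p, (shiftedRising (ZMod p) m).eval x ^ n * ((x + (i + 1))⁻¹) ^ 2 = 0 := by
  set g := ∏ j ∈ (range m).erase i, (X + C ((j : ZMod p) + 1)) with hg
  have hfac : shiftedRising (ZMod p) m = (X + C ((i : ZMod p) + 1)) * g :=
    (mul_prod_erase _ _ (mem_range.2 hi)).symm
  have hdeg : (g ^ 2 * shiftedRising (ZMod p) m ^ (n - 2)).natDegree < Fintype.card (ZMod p) - 1 := by
    have h1 : g.natDegree ≤ m := by
      refine (natDegree_prod_le _ _).trans ?_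
      simp only [natDegree_X_add_C, sum_const, smul_eq_mul, mul_one]
      exact (card_erase_le).trans_eq (card_range m)
    have h2 : (g ^ 2 * shiftedRising (ZMod p) m ^ (n - 2)).natDegree ≤ 2 * m + (n - 2) * m :=
      natDegree_mul_le_of_le (natDegree_pow_le_of_le _ h1)
        (natDegree_pow_le_of_le _ (natDegree_shiftedRising_le m))
    have h3 : 2 * m + (n - 2) * m = m * n := by
      rw [← add_mul, mul_comm]; congr 1; omega
    rw [ZMod.card]; omega
  rw [← sum_eval_eq_zero_of_natDegree_lt hdeg]
  refine sum_congr rfl fun x _ => ?_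
  obtain ⟨k, rfl⟩ : ∃ k, n = k + 3 := ⟨n - 3, by omega⟩
  have hk : k + 3 - 2 = k + 1 := by omega
  rw [hk, hfac]
  simp only [eval_mul, eval_pow, eval_add, eval_X, eval_C]
  by_cases h : x + (i + 1) = 0
  · simp [h]
  · field_simp
    ring

theorem sum_shiftedRising_pow_mul_zmodHarmonic {p : ℕ} [Fact p.Prime] {m n : ℕ} (hn : 2 < n)
    (hm : 0 < m) (hpar : Even (m * n)) (hmn : m * n + 1 < p) :
    ∑ x : ZMod p, (shiftedRising (ZMod p) m).eval x ^ n * zmodHarmonic p x = 0 := by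
  have hp : 3 < p := by nlinarith
  set T := ∑ x : ZMod p, (shiftedRising (ZMod p) m).eval x ^ n * zmodHarmonic p x with hT
  have h1 : T = -∑ x : ZMod p, (shiftedRising (ZMod p) m).eval x ^ n * zmodHarmonic p (x + m) := by
    rw [hT, ← Equiv.sum_comp (Equiv.subLeft (-1 - m : ZMod p)), ← sum_neg_distrib]
    refine sum_congr rfl fun x _ => ?_
    rw [Equiv.subLeft_apply, shiftedRising_eval_reflect, mul_pow, ← pow_mul, hpar.neg_one_pow,
      show (-1 - m - x : ZMod p) = -1 - (x + m) by ring, zmodHarmonic_neg hp]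
    ring
  have h2 : T = -T := by
    conv_lhs => rw [h1]
    simp_rw [zmodHarmonic_add_natCast hp, mul_add, sum_add_distrib, mul_sum]
    rw [sum_comm (s := univ), sum_eq_zero (s := range m), add_zero]
    intro i hi
    exact sum_shiftedRising_pow_mul_inv_sq hn (mem_range.1 hi) hmn
  have h3 : (2 : ZMod p) ≠ 0 := by
    have : ((2 : ℕ) : ZMod p) ≠ 0 := by
      rw [Ne, ZMod.natCast_eq_zero_iff]
      exact fun h => by have := Nat.le_of_dvd (by norm_num) h; omega
    exact_mod_cast this
  exact (mul_eq_zero.1 (by linear_combination h2 : 2 * T = 0)).resolve_left h3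

theorem PadicInt.p_dvd_iff_toZMod_eq_zero {p : ℕ} [Fact p.Prime] (x : ℤ_[p]) :
    (p : ℤ_[p]) ∣ x ↔ PadicInt.toZMod x = 0 := by
  rw [← RingHom.mem_ker, PadicInt.ker_toZMod, PadicInt.maximalIdeal_eq_span_p,
    Ideal.mem_span_singleton]

theorem PadicInt.isUnit_iff_toZMod_ne_zero {p : ℕ} [Fact p.Prime] (x : ℤ_[p]) :
    IsUnit x ↔ PadicInt.toZMod x ≠ 0 := by
  rw [Ne, ← RingHom.mem_ker, PadicInt.ker_toZMod, IsLocalRing.mem_maximalIdeal, mem_nonunits_iff,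
    not_not]

theorem ZMod.natCast_ne_zero_of_lt {p k : ℕ} (h0 : 0 < k) (h : k < p) : (k : ZMod p) ≠ 0 := by
  rw [Ne, ZMod.natCast_eq_zero_iff]
  exact Nat.not_dvd_of_pos_of_lt h0 h

theorem PadicInt.isUnit_natCast_of_lt {p k : ℕ} [Fact p.Prime] (h0 : 0 < k) (h : k < p) :
    IsUnit (k : ℤ_[p]) := by
  rw [PadicInt.isUnit_iff_toZMod_ne_zero, map_natCast]
  exact ZMod.natCast_ne_zero_of_lt h0 h

theorem p_dvd_sum_shiftedRising_mul_sum_sq {p : ℕ} [Fact p.Prime] {m n : ℕ} (hn : 2 < n)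
    (hm : 0 < m) (hpar : Even (m * n)) (hmn : m * n + 1 < p) {v : ℕ → ℤ_[p]}
    (hv : ∀ i < p - 1, ((i : ℤ_[p]) + 1) * v i = 1) :
    (p : ℤ_[p]) ∣ ∑ j ∈ range p, (shiftedRising ℤ_[p] m).eval (j : ℤ_[p]) ^ n *
      ∑ i ∈ range j, v i ^ 2 := by
  rw [PadicInt.p_dvd_iff_toZMod_eq_zero, map_sum,
    ← sum_shiftedRising_pow_mul_zmodHarmonic hn hm hpar hmn, ← sum_natCast_zmod]
  refine sum_congr rfl fun j hj => ?_
  have hj := mem_range.1 hj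
  rw [map_mul, map_pow, map_sum, zmodHarmonic, ZMod.val_cast_of_lt hj, shiftedRising_eval,
    shiftedRising_eval]
  congr 1
  · simp
  · refine sum_congr rfl fun i hi => ?_
    have hi := mem_range.1 hi
    have h := congrArg PadicInt.toZMod (hv i (by omega))
    simp only [map_mul, map_add, map_natCast, map_one] at h
    rw [map_pow, eq_inv_of_mul_eq_one_right h]

/-- The key congruence: `∑ ((j + 1)_m) ^ n * (j! / (1 + c)_j) ^ n ≡ 0` modulo `p ^ 3`
where `n c = p`. -/
theorem p_pow_three_dvd_sum {p : ℕ} [Fact p.Prime] {m n : ℕ} (hn : 2 < n) (hnp : n < p)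
    (hm : 0 < m) (hpar : Even (m * n)) (hmn : m * n + 1 < p) {c : ℤ_[p]} (hc : n * c = p)
    {v y : ℕ → ℤ_[p]} (hv : ∀ i < p - 1, ((i : ℤ_[p]) + 1) * v i = 1)
    (hy : ∀ i < p - 1, y i * (1 + c * v i) ^ n = 1) :
    (p : ℤ_[p]) ^ 3 ∣ ∑ j ∈ range p, (shiftedRising ℤ_[p] m).eval (j : ℤ_[p]) ^ n *
      ∏ i ∈ range j, y i := by
  have hpc : (p : ℤ_[p]) ∣ c :=
    (PadicInt.isUnit_natCast_of_lt (by omega) hnp).dvd_mul_left.1 hc.symm.dvd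
  choose! r hr using exists_prod_eq_prod_add_sum hy
  have hsum : ∑ j ∈ range p, (shiftedRising ℤ_[p] m).eval (j : ℤ_[p]) ^ n * ∏ i ∈ range j, y i
      = ∑ j ∈ range (p - 1 + 1), (shiftedRising ℤ_[p] m ^ n).eval (j : ℤ_[p]) *
          ((-1) ^ j * ((p - 1).choose j : ℤ_[p]))
        + (n + 1).choose 2 * (c ^ 2 * ∑ j ∈ range p,
          (shiftedRising ℤ_[p] m).eval (j : ℤ_[p]) ^ n * ∑ i ∈ range j, v i ^ 2)
        + c ^ 3 * ∑ j ∈ range p, (shiftedRising ℤ_[p] m).eval (j : ℤ_[p]) ^ n * r j := by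
    rw [show p - 1 + 1 = p by omega]
    simp only [mul_sum (s := range p), ← sum_add_distrib]
    refine sum_congr rfl fun j hj => ?_
    have hj : j ≤ p - 1 := by have := mem_range.1 hj; omega
    rw [hr j hj, hc, prod_one_sub_eq_choose hv j hj, eval_pow]
    ring
  have hdeg : (shiftedRising ℤ_[p] m ^ n).natDegree < p - 1 := by
    have := natDegree_pow_le_of_le n (natDegree_shiftedRising_le (R := ℤ_[p]) m)
    rw [mul_comm] at this
    omega
  rw [hsum, sum_eval_mul_choose_eq_zero hdeg, zero_add]
  refine dvd_add (Dvd.dvd.mul_left ?_ _) ((pow_dvd_pow_of_dvd hpc 3).mul_right _)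
  rw [pow_succ]
  exact mul_dvd_mul (pow_dvd_pow_of_dvd hpc 2)
    (p_dvd_sum_shiftedRising_mul_sum_sq hn hm hpar hmn hv)

theorem ascPochhammer_eval_eq_prod {R : Type*} [CommRing R] (k : ℕ) (x : R) :
    (ascPochhammer R k).eval x = ∏ i ∈ range k, (x + i) := by
  induction k with
  | zero => simp
  | succ k ih => rw [ascPochhammer_succ_eval, ih, prod_range_succ]

theorem factorial_add_eq {R : Type*} [CommRing R] (m j : ℕ) :
    ((m + j).factorial : R) = (shiftedRising R m).eval (j : R) * ∏ i ∈ range j, ((i : R) + 1) := by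
  rw [← prod_range_add_one_eq_factorial, shiftedRising_eval, add_comm m j, prod_range_add]
  push_cast
  rw [mul_comm]
  congr 1
  exact prod_congr rfl fun i _ => by ring

/-- A rational number whose image in `ℚ_[p]` is `p ^ e` times a `p`-adic integer is `p ^ e`
times a fraction with denominator prime to `p`. -/
theorem exists_eq_pow_mul_div_of_padicInt {p : ℕ} [Fact p.Prime] {x : ℚ} {z : ℤ_[p]} {e : ℕ}
    (hx : (x : ℚ_[p]) = z) (hz : (p : ℤ_[p]) ^ e ∣ z) :
    ∃ a b : ℤ, ¬ ((p : ℤ) ∣ b) ∧ x = (p : ℚ) ^ e * a / b := by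
  obtain ⟨w, rfl⟩ := hz
  have hp : p ≠ 0 := (Fact.out : p.Prime).ne_zero
  have hp' : ((p : ℚ_[p])) ≠ 0 := by exact_mod_cast hp
  have hp'' : (p : ℚ) ≠ 0 := by exact_mod_cast hp
  have hr : ((x / p ^ e : ℚ) : ℚ_[p]) = w := by
    push_cast at hx ⊢
    rw [hx]
    field_simp
  have hnorm : ‖((x / p ^ e : ℚ) : ℚ_[p])‖ ≤ 1 := by rw [hr]; exact w.norm_le_one
  refine ⟨(x / p ^ e).num, (x / p ^ e).den, ?_, ?_⟩
  · have hu := PadicInt.isUnit_den _ hnorm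
    rw [PadicInt.isUnit_iff_toZMod_ne_zero, map_natCast, Ne, ZMod.natCast_eq_zero_iff] at hu
    exact_mod_cast hu
  · rw [mul_div_assoc, Int.cast_natCast, Rat.num_div_den]
    field_simp

theorem isUnit_add_natCast {p : ℕ} [Fact p.Prime] {m i : ℕ} {c : ℤ_[p]} (hc : (p : ℤ_[p]) ∣ c)
    (hm : m < p) (hi : i < p) (him : m = 0 → i + 1 < p) (hne : i + 1 ≠ m) :
    IsUnit (c - m + 1 + i) := by
  rw [PadicInt.isUnit_iff_toZMod_ne_zero]
  rw [PadicInt.p_dvd_iff_toZMod_eq_zero] at hc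
  simp only [map_add, map_sub, map_natCast, map_one, hc]
  rcases lt_or_gt_of_ne hne with h | h
  · obtain ⟨d, rfl⟩ := Nat.exists_eq_add_of_lt h
    have := ZMod.natCast_ne_zero_of_lt (p := p) (k := d + 1) (by omega) (by omega)
    intro h0
    apply this
    push_cast at h0 ⊢
    linear_combination -h0
  · obtain ⟨d, hd⟩ := Nat.exists_eq_add_of_lt h
    have := ZMod.natCast_ne_zero_of_lt (p := p) (k := d + 1) (by omega) (by omega)
    intro h0
    apply this
    have hd := congrArg (Nat.cast : ℕ → ZMod p) hd
    push_cast at h0 hd ⊢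
    linear_combination h0 - hd

/-- The terms of the sum with index below `m` (or all of them when `m = 0`) are `p`-integral
multiples of `p ^ n`. -/
theorem exists_term_of_lt {p : ℕ} [Fact p.Prime] {m n k : ℕ} {c : ℤ_[p]} (hc : (p : ℤ_[p]) ∣ c)
    (hm : m < p) (hk : k < p) (hkm : k < m ∨ m = 0) :
    (ascPochhammer ℤ_[p] k).eval (c - m + 1) ≠ 0 ∧ ∃ z : ℤ_[p],
      (p : ℤ_[p]) ^ n * (k.factorial : ℤ_[p]) ^ n
        = (p : ℤ_[p]) ^ n * z * (ascPochhammer ℤ_[p] k).eval (c - m + 1) ^ n := by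
  have hu : IsUnit ((ascPochhammer ℤ_[p] k).eval (c - m + 1)) := by
    rw [ascPochhammer_eval_eq_prod]
    refine IsUnit.prod_iff.2 fun i hi => ?_
    have := mem_range.1 hi
    exact isUnit_add_natCast hc hm (by omega) (by omega) (by omega)
  obtain ⟨w, hw⟩ := hu.exists_left_inv
  refine ⟨hu.ne_zero, k.factorial ^ n * w ^ n, ?_⟩
  have : w ^ n * (ascPochhammer ℤ_[p] k).eval (c - m + 1) ^ n = 1 := by
    rw [← mul_pow, hw, one_pow]
  linear_combination (-(p : ℤ_[p]) ^ n * k.factorial ^ n) * this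

theorem p_dvd_shiftedRising_eval {R : Type*} [CommRing R] {p m j : ℕ} (hj : j < p)
    (h : p ≤ j + m) : (p : R) ∣ (shiftedRising R m).eval (j : R) := by
  rw [shiftedRising_eval]
  have hmem : p - j - 1 ∈ range m := mem_range.2 (by omega)
  refine Dvd.dvd.trans ?_ (dvd_prod_of_mem _ hmem)
  have : p = j + (p - j - 1 + 1) := by omega
  have h2 := congrArg (Nat.cast : ℕ → R) this
  push_cast at h2
  rw [← h2]

/-- The sum of the theorem, written with `m = q - 1` and `c = p / n` in the `p`-adic integers. -/
theorem exists_sum_eq_padicInt {p : ℕ} [Fact p.Prime] {m n : ℕ} (hn : 2 < n) (hnp : n < p)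
    (hpar : Even (m * n)) (hmn : m * n + 1 < p) {c : ℤ_[p]} (hc : n * c = p) :
    ∃ z : ℤ_[p], (p : ℤ_[p]) ^ 3 ∣ z ∧
      (p : ℚ_[p]) ^ n * ∑ k ∈ range p, (k.factorial : ℚ_[p]) ^ n /
        (((ascPochhammer ℤ_[p] k).eval (c - m + 1) : ℤ_[p]) : ℚ_[p]) ^ n = z := by
  have hpc : (p : ℤ_[p]) ∣ c :=
    (PadicInt.isUnit_natCast_of_lt (by omega) hnp).dvd_mul_left.1 hc.symm.dvd
  have hmp : m < p := by nlinarith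
  have hc0 : c ≠ 0 := by
    rintro rfl
    rw [mul_zero, eq_comm, Nat.cast_eq_zero] at hc
    omega
  suffices H : ∃ z : ℕ → ℤ_[p], (p : ℤ_[p]) ^ 3 ∣ ∑ k ∈ range p, z k ∧
      ∀ k < p, (ascPochhammer ℤ_[p] k).eval (c - m + 1) ≠ 0 ∧
        (p : ℤ_[p]) ^ n * (k.factorial : ℤ_[p]) ^ n
          = z k * (ascPochhammer ℤ_[p] k).eval (c - m + 1) ^ n by
    obtain ⟨z, hz, H⟩ := H
    refine ⟨_, hz, ?_⟩
    rw [mul_sum, PadicInt.coe_sum]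
    refine sum_congr rfl fun k hk => ?_
    obtain ⟨h0, h1⟩ := H k (mem_range.1 hk)
    have h0' : (((ascPochhammer ℤ_[p] k).eval (c - m + 1) : ℤ_[p]) : ℚ_[p]) ^ n ≠ 0 :=
      pow_ne_zero _ (by simpa using h0)
    rw [← mul_div_assoc, div_eq_iff h0']
    exact_mod_cast congrArg (PadicInt.Coe.ringHom (p := p)) h1
  have hpow : (p : ℤ_[p]) ^ 3 ∣ (p : ℤ_[p]) ^ n := pow_dvd_pow _ hn
  have hlow : ∀ k < p, k < m ∨ m = 0 → _ := fun k hk hkm =>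
    exists_term_of_lt (n := n) hpc hmp hk hkm
  rcases Nat.eq_zero_or_pos m with rfl | hm
  · choose! z hz using fun k hk => (hlow k hk (Or.inr rfl)).2
    exact ⟨fun k => p ^ n * z k, dvd_sum fun k _ => hpow.mul_right _,
      fun k hk => ⟨(hlow k hk (Or.inr rfl)).1, hz k hk⟩⟩
  choose! z hz using fun k (hk : k < m) => (hlow k (by omega) (Or.inl hk)).2
  obtain ⟨l, rfl⟩ : ∃ l, m = l + 1 := ⟨m - 1, by omega⟩
  obtain ⟨d, hd⟩ := Nat.exists_eq_add_of_lt hmp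
  have hU : IsUnit (∏ i ∈ range l, (c - (l + 1 : ℕ) + 1 + i)) :=
    IsUnit.prod_iff.2 fun i hi => by
      have := mem_range.1 hi
      exact isUnit_add_natCast hpc hmp (by omega) (by omega) (by omega)
  obtain ⟨u, hu⟩ := hU.exists_left_inv
  have hv : ∀ i < p - 1, ∃ v : ℤ_[p], ((i : ℤ_[p]) + 1) * v = 1 := fun i hi => by
    have := PadicInt.isUnit_natCast_of_lt (p := p) (k := i + 1) (by omega) (by omega)
    push_cast at this
    exact this.exists_right_inv
  have hw : ∀ i < p - 1, ∃ w : ℤ_[p], w * (c + 1 + i) = 1 := fun i hi => by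
    have := isUnit_add_natCast (m := 0) hpc (by omega) (show i < p by omega) (by omega) (by omega)
    rw [Nat.cast_zero, sub_zero] at this
    exact this.exists_left_inv
  choose! v hv using hv
  choose! w hw using hw
  have hy : ∀ i < p - 1, (((i : ℤ_[p]) + 1) * w i) ^ n * (1 + c * v i) ^ n = 1 := fun i hi => by
    have : ((i : ℤ_[p]) + 1) * w i * (1 + c * v i) = 1 := by
      linear_combination hw i hi + w i * c * hv i hi
    rw [← mul_pow, this, one_pow]
  have key := p_pow_three_dvd_sum hn hnp hm hpar hmn hc hv hy
  set f : ℕ → ℤ_[p] := fun j => (shiftedRising ℤ_[p] (l + 1)).eval (j : ℤ_[p]) ^ n *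
      ∏ i ∈ range j, (((i : ℤ_[p]) + 1) * w i) ^ n with hf
  refine ⟨fun k => if k < l + 1 then p ^ n * z k else (n * u) ^ n * f (k - (l + 1)), ?_, ?_⟩
  · have hsplit : p = (l + 1) + (d + 1) := by omega
    conv => enter [2, 1]; rw [hsplit]
    rw [sum_range_add]
    refine dvd_add (dvd_sum fun k hk => ?_) ?_
    · rw [if_pos (mem_range.1 hk)]
      exact hpow.mul_right _
    · simp only [add_lt_iff_neg_left, not_lt_zero, if_false, Nat.add_sub_cancel_left, ← mul_sum]
      refine Dvd.dvd.mul_left ?_ _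
      have hsplit : p = (d + 1) + (l + 1) := by omega
      conv at key => enter [2, 1]; rw [hsplit]
      rw [sum_range_add] at key
      refine (dvd_add_left (dvd_sum fun i hi => ?_)).1 key
      have := mem_range.1 hi
      exact (hpow.trans (pow_dvd_pow_of_dvd
        (p_dvd_shiftedRising_eval (by omega) (by omega)) n)).mul_right _
  · intro k hk
    by_cases hkl : k < l + 1
    · exact ⟨(hlow k hk (Or.inl hkl)).1, by simpa only [if_pos hkl] using hz k hkl⟩
    obtain ⟨j, rfl⟩ := Nat.exists_eq_add_of_le (not_lt.1 hkl)
    simp only [if_neg hkl, Nat.add_sub_cancel_left]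
    set U := ∏ i ∈ range l, (c - (l + 1 : ℕ) + 1 + i) with hUdef
    have hP : (ascPochhammer ℤ_[p] (l + 1 + j)).eval (c - (l + 1 : ℕ) + 1)
        = U * c * ∏ i ∈ range j, (c + 1 + i) := by
      rw [ascPochhammer_eval_eq_prod, prod_range_add, prod_range_succ]
      congr 1
      · congr 1
        push_cast
        ring
      · exact prod_congr rfl fun i _ => by push_cast; ring
    have hW : (∏ i ∈ range j, w i) * ∏ i ∈ range j, (c + 1 + i) = 1 := by
      rw [← prod_mul_distrib]
      exact prod_eq_one fun i hi => hw i (by have := mem_range.1 hi; omega)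
    rw [hP]
    refine ⟨mul_ne_zero (mul_ne_zero hU.ne_zero hc0) (right_ne_zero_of_mul_eq_one hW), ?_⟩
    simp only [hf]
    rw [prod_pow, prod_mul_distrib, factorial_add_eq, ← hc]
    simp only [← mul_pow]
    congr 1
    set W := ∏ i ∈ range j, (c + 1 + (i : ℤ_[p]))
    set V := ∏ i ∈ range j, w i
    set J := ∏ i ∈ range j, ((i : ℤ_[p]) + 1)
    set G := (shiftedRising ℤ_[p] (l + 1)).eval (j : ℤ_[p])
    linear_combination (-n * c * G * J) * hu + (-n * c * G * J * u * U) * hW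


/-- For integers `n > 2` and `q > 0` with `n` even or `q` odd, and any prime
`p > max {n, (q-1)n+1}`, the rational number
`p^n * ∑_{k=0}^{p-1} (1)_k^n / (p/n - q + 2)_k^n`
is congruent to `0` modulo `p^3`, i.e. it can be written as `p^3 * a / b` with `p ∤ b`. -/
theorem stmt_1 (n q : ℕ) (hn : 2 < n) (hq : 0 < q) (hpar : Even n ∨ Odd q)
    (p : ℕ) (hp : p.Prime) (hgt : p > max n ((q - 1) * n + 1)) :
    ∃ a b : ℤ, ¬ ((p : ℤ) ∣ b) ∧
      (p : ℚ) ^ n * ∑ k ∈ Finset.range p,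
          ((ascPochhammer ℚ k).eval 1) ^ n /
            ((ascPochhammer ℚ k).eval ((p : ℚ) / (n : ℚ) - (q : ℚ) + 2)) ^ n
        = (p : ℚ) ^ 3 * a / b := by
  have : Fact p.Prime := ⟨hp⟩
  obtain ⟨m, rfl⟩ : ∃ m, q = m + 1 := ⟨q - 1, by omega⟩
  rw [Nat.add_sub_cancel] at hgt
  obtain ⟨hnp, hmn⟩ := max_lt_iff.1 hgt
  have hpar' : Even (m * n) := by
    rw [Nat.even_mul]
    rcases hpar with h | h
    · exact Or.inr h
    · exact Or.inl (by rcases h with ⟨k, hk⟩; exact ⟨k, by omega⟩)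
  obtain ⟨w, hw⟩ := (PadicInt.isUnit_natCast_of_lt (p := p) (k := n) (by omega) hnp).exists_right_inv
  have hc : (n : ℤ_[p]) * (w * p) = p := by rw [← mul_assoc, hw, one_mul]
  obtain ⟨z, hz, hsum⟩ := exists_sum_eq_padicInt hn hnp hpar' hmn hc
  refine exists_eq_pow_mul_div_of_padicInt (z := z) ?_ hz
  rw [← hsum]
  have hn0 : (n : ℚ_[p]) ≠ 0 := by
    have : n ≠ 0 := by omega
    exact_mod_cast this
  have hcQ : PadicInt.Coe.ringHom w * (p : ℚ_[p]) = p / n := by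
    rw [eq_div_iff hn0, mul_comm]
    simpa only [map_mul, map_natCast] using congrArg (PadicInt.Coe.ringHom (p := p)) hc
  have hP : ∀ k, (((ascPochhammer ℤ_[p] k).eval (w * p - m + 1) : ℤ_[p]) : ℚ_[p])
      = (((ascPochhammer ℚ k).eval ((p : ℚ) / (n : ℚ) - ((m + 1 : ℕ) : ℚ) + 2) : ℚ) : ℚ_[p]) := by
    intro k
    rw [ascPochhammer_eval_eq_prod, ascPochhammer_eval_eq_prod, Rat.cast_prod]
    refine (map_prod (PadicInt.Coe.ringHom (p := p)) _ _).trans (prod_congr rfl fun i _ => ?_)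
    simp only [map_add, map_sub, map_mul, map_natCast, map_one, hcQ]
    push_cast
    ring
  simp only [ascPochhammer_eval_one, hP]
  push_cast
  rfl
end

section
/- (Karlsson–Minton formula) Let r be a positive integer, let m_1, m_2, ..., m_r be nonnegative integers, let a be a complex number with Re(-a) > m_1 + m_2 + ... + m_r, and let b_1, ..., b_r be complex numbers none of which is zero or a negative integer (so that (b_i)_k ≠ 0 for all k ≥ 0). Then the series ∑_{k=0}^{∞} (a)_k (b_1 + m_1)_k ··· (b_r + m_r)_k / ((1)_k (b_1)_k ··· (b_r)_k) converges and its sum equals 0. -/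
open Polynomial Filter Topology

lemma ascPochhammer_eval_ne_zero_of_forall_add_ne_zero {b : ℂ} (hb : ∀ k : ℕ, b + (k : ℂ) ≠ 0)
    (n : ℕ) : (ascPochhammer ℂ n).eval b ≠ 0 := by
  induction n with
  | zero => simp
  | succ n ih => rw [ascPochhammer_succ_eval]; exact mul_ne_zero ih (hb n)

lemma ascPochhammer_eval_add_div_eval {b : ℂ} (hb : ∀ k : ℕ, b + (k : ℂ) ≠ 0) (m k : ℕ) :
    (ascPochhammer ℂ k).eval (b + m) / (ascPochhammer ℂ k).eval b =
      (ascPochhammer ℂ m).eval (k + b) / (ascPochhammer ℂ m).eval b := by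
  have h₁ := congrArg (eval b) (ascPochhammer_mul ℂ m k)
  have h₂ := congrArg (eval b) (ascPochhammer_mul ℂ k m)
  rw [add_comm k m] at h₂
  simp only [eval_mul, eval_comp, eval_add, eval_X, eval_natCast] at h₁ h₂
  rw [div_eq_div_iff (ascPochhammer_eval_ne_zero_of_forall_add_ne_zero hb k)
    (ascPochhammer_eval_ne_zero_of_forall_add_ne_zero hb m), add_comm (k : ℂ) b]
  linear_combination h₁ - h₂

/-- The coefficients `(a)_k / k!` of the binomial series of `(1 - x) ^ (-a)`. -/
noncomputable def binomialCoeff (a : ℂ) (k : ℕ) : ℂ :=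
  (ascPochhammer ℂ k).eval a / (k.factorial : ℂ)

lemma binomialCoeff_succ (a : ℂ) (k : ℕ) :
    ((k : ℂ) + 1) * binomialCoeff a (k + 1) = (a + k) * binomialCoeff a k := by
  have h₁ : (k.factorial : ℂ) ≠ 0 := Nat.cast_ne_zero.2 k.factorial_ne_zero
  have h₂ : (k : ℂ) + 1 ≠ 0 := Nat.cast_add_one_ne_zero k
  simp only [binomialCoeff, ascPochhammer_succ_eval, Nat.factorial_succ, Nat.cast_mul,
    Nat.cast_add, Nat.cast_one]
  field_simp

lemma binomialCoeff_succ_shift (a : ℂ) (k : ℕ) :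
    ((k : ℂ) + 1) * binomialCoeff a (k + 1) = a * binomialCoeff (a + 1) k := by
  have h₁ : (k.factorial : ℂ) ≠ 0 := Nat.cast_ne_zero.2 k.factorial_ne_zero
  have h₂ : (k : ℂ) + 1 ≠ 0 := Nat.cast_add_one_ne_zero k
  simp only [binomialCoeff, ascPochhammer_succ_left, eval_mul, eval_comp, eval_add, eval_X,
    eval_one, Nat.factorial_succ, Nat.cast_mul, Nat.cast_add, Nat.cast_one]
  field_simp

lemma sum_range_binomialCoeff (a : ℂ) (n : ℕ) :
    a * ∑ k ∈ Finset.range n, binomialCoeff a k = n * binomialCoeff a n := by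
  induction n with
  | zero => simp
  | succ n ih =>
    rw [Finset.sum_range_succ, mul_add, ih]
    push_cast
    rw [binomialCoeff_succ]
    ring

lemma norm_add_natCast_le {a : ℂ} (ha : a.re < 0) {k : ℕ} (hk : ‖a‖ ^ 2 ≤ k * -a.re) :
    ‖a + k‖ ≤ k - -a.re / 2 := by
  have h₁ : ‖a‖ ^ 2 = a.re ^ 2 + a.im ^ 2 := by
    rw [Complex.sq_norm, Complex.normSq_apply]; ring
  have h₂ : ‖a + k‖ ^ 2 = (a.re + k) ^ 2 + a.im ^ 2 := by
    rw [Complex.sq_norm, Complex.normSq_apply]; simp; ring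
  have h₃ : -a.re ≤ k := by nlinarith [sq_nonneg a.im]
  exact abs_le_of_sq_le_sq' (by nlinarith [sq_nonneg a.re]) (by linarith) |>.2

lemma summable_norm_binomialCoeff {a : ℂ} (ha : a.re < 0) :
    Summable fun k => ‖binomialCoeff a k‖ := by
  obtain ⟨K, hK⟩ := exists_nat_ge (‖a‖ ^ 2 / -a.re)
  have hσ : 0 < -a.re := neg_pos.2 ha
  rw [div_le_iff₀ hσ] at hK
  rw [← summable_nat_add_iff K]
  set v : ℕ → ℝ := fun k => k * ‖binomialCoeff a k‖ with hv
  have step (n : ℕ) : -a.re / 2 * ‖binomialCoeff a (n + K)‖ ≤ v (n + K) - v (n + 1 + K) := by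
    have h := congrArg norm (binomialCoeff_succ a (n + K))
    rw [norm_mul, norm_mul, ← Nat.cast_succ, Complex.norm_natCast] at h
    have hn := norm_add_natCast_le (k := n + K) ha
      (hK.trans (by push_cast; nlinarith [(Nat.cast_nonneg n : (0 : ℝ) ≤ n)]))
    have h' : v (n + 1 + K) = ‖a + ((n + K : ℕ) : ℂ)‖ * ‖binomialCoeff a (n + K)‖ := by
      rw [← h, hv, Nat.add_right_comm]
    rw [h', hv]
    nlinarith [norm_nonneg (binomialCoeff a (n + K))]
  rw [← summable_mul_left_iff (half_pos hσ).ne']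
  refine summable_of_sum_range_le (c := v K) (fun n => by positivity) fun n => ?_
  calc _ ≤ ∑ i ∈ Finset.range n, (v (i + K) - v (i + 1 + K)) := Finset.sum_le_sum fun i _ => step i
    _ = v (0 + K) - v (n + K) := Finset.sum_range_sub' (fun i => v (i + K)) n
    _ ≤ v K := by
      have : 0 ≤ v (n + K) := by positivity
      rw [zero_add]; linarith

lemma hasSum_binomialCoeff {a : ℂ} (ha : a.re < 0) : HasSum (binomialCoeff a) 0 := by
  have hs := summable_norm_binomialCoeff ha
  have ha0 : a ≠ 0 := by rintro rfl; simp at ha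
  obtain ⟨S, hS⟩ := hs.of_norm
  have ht : Tendsto (fun n : ℕ => (n : ℝ) * ‖binomialCoeff a n‖) atTop (𝓝 ‖a * S‖) := by
    refine ((hS.tendsto_sum_nat.const_mul a).norm).congr fun n => ?_
    rw [sum_range_binomialCoeff, norm_mul, Complex.norm_natCast]
  suffices S = 0 from this ▸ hS
  by_contra hS0
  have hpos : 0 < ‖a * S‖ := norm_pos_iff.2 (mul_ne_zero ha0 hS0)
  refine Real.not_summable_natCast_inv ?_
  refine Summable.of_norm_bounded_eventually_nat (hs.mul_left (2 / ‖a * S‖)) ?_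
  filter_upwards [ht.eventually (lt_mem_nhds (half_lt_self hpos)), eventually_gt_atTop 0]
    with n hn hn0
  have hn0' : (0 : ℝ) < n := Nat.cast_pos.2 hn0
  rw [norm_inv, Real.norm_natCast, inv_le_iff_one_le_mul₀ hn0', div_mul_eq_mul_div,
    div_mul_eq_mul_div, le_div_iff₀ hpos]
  linarith

lemma hasSum_binomialCoeff_mul_eval (d : ℕ) {a : ℂ} {P : ℂ[X]} (hP : P.natDegree ≤ d)
    (ha : (d : ℝ) < -a.re) : HasSum (fun k : ℕ => binomialCoeff a k * P.eval (k : ℂ)) 0 := by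
  induction d generalizing a P with
  | zero =>
    rw [eq_C_of_natDegree_le_zero hP]
    simpa using (hasSum_binomialCoeff (a := a) (by simpa using ha)).mul_right (P.coeff 0)
  | succ d ih =>
    push_cast at ha
    have hd : (0 : ℝ) ≤ d := d.cast_nonneg
    have h₀ := (hasSum_binomialCoeff (a := a) (by linarith)).mul_right (P.coeff 0)
    have hQ : (P.divX.comp (X + C 1)).natDegree ≤ d := by
      rw [natDegree_comp, natDegree_X_add_C, mul_one, natDegree_divX_eq_natDegree_tsub_one]
      omega
    have h₁ := (ih (a := a + 1) hQ (by simp; linarith)).mul_left a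
    have h₂ : HasSum (fun k : ℕ => binomialCoeff a k * (k * P.divX.eval (k : ℂ))) 0 := by
      rw [← hasSum_nat_add_iff' 1]
      have heq (k : ℕ) : binomialCoeff a (k + 1) * (((k + 1 : ℕ) : ℂ) *
          P.divX.eval ((k + 1 : ℕ) : ℂ)) =
          a * (binomialCoeff (a + 1) k * (P.divX.comp (X + C 1)).eval (k : ℂ)) := by
        simp only [eval_comp, eval_add, eval_X, eval_C]
        push_cast
        linear_combination (P.divX.eval ((k : ℂ) + 1)) * binomialCoeff_succ_shift a k
      simpa only [heq, Finset.sum_range_one, Nat.cast_zero, zero_mul, mul_zero, sub_zero] using h₁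
    have heq (k : ℕ) : binomialCoeff a k * P.eval (k : ℂ) =
        binomialCoeff a k * P.coeff 0 + binomialCoeff a k * (k * P.divX.eval (k : ℂ)) := by
      have h := congrArg (eval (k : ℂ)) (X_mul_divX_add P)
      simp only [eval_add, eval_mul, eval_X, eval_C] at h
      rw [← h]
      ring
    simpa only [heq, zero_mul, add_zero] using h₀.add h₂

/-- Karlsson–Minton formula: Let `r ≥ 1`, let `m₁, …, m_r` be nonnegative
integers, let `a : ℂ` with `Re(-a) > m₁ + ⋯ + m_r`, and let `b₁, …, b_r` be complex numbers
none of which is zero or a negative integer. Then the series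
`∑_{k=0}^∞ (a)_k (b₁+m₁)_k ⋯ (b_r+m_r)_k / ((1)_k (b₁)_k ⋯ (b_r)_k)` converges to `0`. -/
theorem stmt_3 (r : ℕ) (hr : 0 < r) (m : Fin r → ℕ) (a : ℂ)
    (ha : (∑ i, (m i : ℝ)) < (-a).re)
    (b : Fin r → ℂ) (hb : ∀ i, ∀ k : ℕ, b i + (k : ℂ) ≠ 0) :
    HasSum (fun k : ℕ =>
      ((ascPochhammer ℂ k).eval a * ∏ i, (ascPochhammer ℂ k).eval (b i + (m i : ℂ))) /
        ((ascPochhammer ℂ k).eval 1 * ∏ i, (ascPochhammer ℂ k).eval (b i))) 0 := by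
  set P : ℂ[X] := ∏ i, C ((ascPochhammer ℂ (m i)).eval (b i))⁻¹ *
    (ascPochhammer ℂ (m i)).comp (X + C (b i)) with hP
  have hdeg : P.natDegree ≤ ∑ i, m i := by
    refine (natDegree_prod_le _ _).trans (Finset.sum_le_sum fun i _ => ?_)
    refine (natDegree_C_mul_le _ _).trans ?_
    rw [natDegree_comp, natDegree_X_add_C, mul_one, ascPochhammer_natDegree]
  have heq (k : ℕ) :
      ((ascPochhammer ℂ k).eval a * ∏ i, (ascPochhammer ℂ k).eval (b i + (m i : ℂ))) /
        ((ascPochhammer ℂ k).eval 1 * ∏ i, (ascPochhammer ℂ k).eval (b i)) =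
      binomialCoeff a k * P.eval (k : ℂ) := by
    rw [mul_div_mul_comm, ascPochhammer_eval_one, ← Finset.prod_div_distrib, hP, eval_prod,
      binomialCoeff]
    congr 1
    refine Finset.prod_congr rfl fun i _ => ?_
    rw [ascPochhammer_eval_add_div_eval (hb i)]
    simp only [eval_mul, eval_C, eval_comp, eval_add, eval_X]
    rw [div_eq_inv_mul]
  simpa only [heq] using hasSum_binomialCoeff_mul_eval (∑ i, m i) hdeg (by exact_mod_cast ha)
end

section
/- Let n > 2 and q > 0 be integers and let p be a prime with p > (q-1)n + 1. Then for all complex numbers x and y such that neither x nor y is a negative integer or, when increased by any of 1, 2, ..., p-1, equals 0 (i.e., (1+x)_k ≠ 0 and (1+y)_k ≠ 0 for all 0 ≤ k ≤ p-1), one has the exact identity ∑_{k=0}^{p-1} (1-p)_k (q+x)_k (q+y)_k (q)_k^{n-2} / ((1)_k^{n-1} (1+x)_k (1+y)_k) = 0. -/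
open Polynomial Finset in
/-- If `P` is a polynomial of degree less than `n`, then its `n`-th forward difference at `0`,
written as a sum of Pochhammer symbols, vanishes. -/
theorem sum_ascPochhammer_neg_mul_eval_eq_zero {P : ℂ[X]} {n : ℕ} (hP : P.natDegree < n) :
    ∑ k ∈ range (n + 1),
      (ascPochhammer ℂ k).eval (-(n : ℂ)) / (ascPochhammer ℂ k).eval 1 * P.eval (k : ℂ) = 0 := by
  have h := congrFun (Polynomial.fwdDiff_iter_eq_zero_of_degree_lt hP) 0
  rw [fwdDiff_iter_eq_sum_shift, Pi.zero_apply] at h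
  rw [← mul_zero ((-1 : ℂ) ^ n), ← h, mul_sum]
  refine sum_congr rfl fun k hk ↦ ?_
  have hkn : k ≤ n := Nat.lt_succ_iff.mp (mem_range.mp hk)
  have hsign : (-1 : ℂ) ^ n * (-1) ^ (n - k) = (-1) ^ k := by
    obtain ⟨m, rfl⟩ := Nat.exists_eq_add_of_le hkn
    rw [Nat.add_sub_cancel_left, pow_add, mul_assoc, ← mul_pow]
    simp
  rw [ascPochhammer_eval_neg_eq_descPochhammer, descPochhammer_eval_eq_descFactorial,
    Nat.descFactorial_eq_factorial_mul_choose, ascPochhammer_eval_one, ← hsign]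
  have : (k.factorial : ℂ) ≠ 0 := by exact_mod_cast k.factorial_ne_zero
  simp only [zsmul_eq_mul, nsmul_eq_mul, mul_one, zero_add]
  push_cast
  field_simp

/-- The two ways of splitting `(a)_{m + k}` into a product. -/
theorem ascPochhammer_eval_mul_eval_add {R : Type*} [CommSemiring R] (a : R) (m k : ℕ) :
    (ascPochhammer R m).eval a * (ascPochhammer R k).eval (a + m) =
      (ascPochhammer R k).eval a * (ascPochhammer R m).eval (a + k) := by
  have h := (ascPochhammer_mul R m k).trans
    ((congrArg (ascPochhammer R) (add_comm m k)).trans (ascPochhammer_mul R k m).symm)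
  simpa using congrArg (Polynomial.eval a) h

/-- If `(a)_m ≠ 0`, the quotient `(a + m)_k / (a)_k` is a polynomial in `k` of degree at
most `m`. -/
theorem exists_eval_eq_ascPochhammer_div {a : ℂ} {m : ℕ} (ha : (ascPochhammer ℂ m).eval a ≠ 0) :
    ∃ P : Polynomial ℂ, P.natDegree ≤ m ∧ ∀ k : ℕ, (ascPochhammer ℂ k).eval a ≠ 0 →
      (ascPochhammer ℂ k).eval (a + m) / (ascPochhammer ℂ k).eval a = P.eval (k : ℂ) := by
  refine ⟨.C ((ascPochhammer ℂ m).eval a)⁻¹ * (ascPochhammer ℂ m).comp (.X + .C a), ?_, ?_⟩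
  · refine (Polynomial.natDegree_C_mul_le _ _).trans ?_
    rw [Polynomial.natDegree_comp, Polynomial.natDegree_X_add_C, ascPochhammer_natDegree, mul_one]
  · intro k hk
    have h := ascPochhammer_eval_mul_eval_add a m k
    simp only [Polynomial.eval_mul, Polynomial.eval_C, Polynomial.eval_comp, Polynomial.eval_add,
      Polynomial.eval_X, add_comm (k : ℂ) a]
    field_simp
    linear_combination h


/-- Let `n > 2`, `q > 0` be integers and `p` a prime with `p > (q-1)n + 1`.
For all complex `x, y` with `(1+x)_k ≠ 0` and `(1+y)_k ≠ 0` for all `0 ≤ k ≤ p-1`,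
`∑_{k=0}^{p-1} (1-p)_k (q+x)_k (q+y)_k (q)_k^{n-2} / ((1)_k^{n-1} (1+x)_k (1+y)_k) = 0`. -/
theorem stmt_4 (n q : ℕ) (hn : 2 < n) (hq : 0 < q)
    (p : ℕ) (hp : p.Prime) (hgt : p > (q - 1) * n + 1) (x y : ℂ)
    (hx : ∀ k ≤ p - 1, (ascPochhammer ℂ k).eval (1 + x) ≠ 0)
    (hy : ∀ k ≤ p - 1, (ascPochhammer ℂ k).eval (1 + y) ≠ 0) :
    ∑ k ∈ Finset.range p,
        ((ascPochhammer ℂ k).eval (1 - (p : ℂ)) * (ascPochhammer ℂ k).eval ((q : ℂ) + x) *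
            (ascPochhammer ℂ k).eval ((q : ℂ) + y) *
            ((ascPochhammer ℂ k).eval (q : ℂ)) ^ (n - 2)) /
          (((ascPochhammer ℂ k).eval 1) ^ (n - 1) * (ascPochhammer ℂ k).eval (1 + x) *
            (ascPochhammer ℂ k).eval (1 + y))
      = 0 := by
  obtain ⟨m, rfl⟩ := Nat.exists_eq_add_of_le' hq
  obtain ⟨r, rfl⟩ := Nat.exists_eq_add_of_le' hn.le
  obtain ⟨N, rfl⟩ := Nat.exists_eq_add_of_le' hp.one_le
  simp only [Nat.add_sub_cancel] at hx hy hgt ⊢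
  have hm : m * (r + 2) < N := by omega
  have hmN : m ≤ N := by nlinarith
  have h1 (k : ℕ) : (ascPochhammer ℂ k).eval 1 ≠ 0 := by
    rw [ascPochhammer_eval_one]
    exact_mod_cast k.factorial_ne_zero
  obtain ⟨A, hA, hAk⟩ := exists_eval_eq_ascPochhammer_div (hx m hmN)
  obtain ⟨B, hB, hBk⟩ := exists_eval_eq_ascPochhammer_div (hy m hmN)
  obtain ⟨C, hC, hCk⟩ := exists_eval_eq_ascPochhammer_div (h1 m)
  have hdeg : (A * B * C ^ r).natDegree < N := by
    refine lt_of_le_of_lt ?_ hm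
    refine (Polynomial.natDegree_mul_le_of_le (Polynomial.natDegree_mul_le_of_le hA hB)
      (Polynomial.natDegree_pow_le_of_le r hC)).trans_eq ?_
    ring
  rw [← sum_ascPochhammer_neg_mul_eval_eq_zero hdeg]
  refine Finset.sum_congr rfl fun k hk ↦ ?_
  have hkN : k ≤ N := Nat.lt_succ_iff.mp (Finset.mem_range.mp hk)
  rw [Polynomial.eval_mul, Polynomial.eval_mul, Polynomial.eval_pow, ← hAk k (hx k hkN),
    ← hBk k (hy k hkN), ← hCk k (h1 k), show r + 2 - 1 = r + 1 from rfl,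
    show (1 : ℂ) - ((N + 1 : ℕ) : ℂ) = -(N : ℂ) by push_cast; ring,
    show ((m + 1 : ℕ) : ℂ) + x = 1 + x + m by push_cast; ring,
    show ((m + 1 : ℕ) : ℂ) + y = 1 + y + m by push_cast; ring,
    show ((m + 1 : ℕ) : ℂ) = 1 + m by push_cast; ring]
  have := h1 k
  have := hx k hkN
  have := hy k hkN
  rw [div_pow, pow_succ]
  field_simp
end

section
/- Let n > 2 and q > 0 be integers such that n is even or q is odd, and let p be a prime with p > max{n, (q-1)n + 1}. Then ∑_{k=0}^{p-q} (q)_k^n / (1)_k^n ≡ 0 (mod p). (Each summand (q)_k/(1)_k = C(q+k-1, k) is a positive integer, so this is an ordinary congruence between integers.) -/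
/-- The values of a polynomial of degree less than `#K - 1` over a finite field `K` sum to zero. -/
theorem FiniteField.sum_eval_eq_zero {K : Type*} [Field K] [Fintype K] (f : Polynomial K)
    (hf : f.natDegree < Fintype.card K - 1) : ∑ x : K, f.eval x = 0 := by
  simp_rw [Polynomial.eval_eq_sum_range]
  rw [Finset.sum_comm]
  refine Finset.sum_eq_zero fun i hi => ?_
  rw [← Finset.mul_sum, FiniteField.sum_pow_lt_card_sub_one K i, mul_zero]
  have := Finset.mem_range.mp hi
  omega

/-- Summing over `ZMod p` is summing over the residues `0, …, p - 1`. -/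
theorem ZMod.sum_eq_sum_range_natCast {M : Type*} [AddCommMonoid M] (p : ℕ) [NeZero p]
    (f : ZMod p → M) : ∑ x : ZMod p, f x = ∑ k ∈ Finset.range p, f k := by
  refine Finset.sum_bij' (fun x _ => x.val) (fun k _ => (k : ZMod p)) ?_ ?_ ?_ ?_ ?_
  · exact fun x _ => Finset.mem_range.mpr x.val_lt
  · simp
  · simp
  · exact fun k hk => ZMod.val_cast_of_lt (Finset.mem_range.mp hk)
  · simp

/-- Modulo a prime `p`, the `n`-th powers of `C(m + k, m)` over `0 ≤ k < p` sum to zero as soon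
as `m * n < p - 1`. -/
theorem ZMod.sum_range_choose_pow_eq_zero (p m n : ℕ) [Fact p.Prime] (hm : m < p)
    (hmn : m * n < p - 1) :
    ∑ k ∈ Finset.range p, (((m + k).choose m : ℕ) : ZMod p) ^ n = 0 := by
  have hfac : ((m.factorial : ℕ) : ZMod p) ≠ 0 := by
    rw [Ne, ZMod.natCast_eq_zero_iff, (Fact.out : p.Prime).dvd_factorial]
    omega
  have heval (k : ℕ) : ((((ascPochhammer (ZMod p) m).comp (Polynomial.X + 1)) ^ n).eval
      (k : ZMod p)) = (m.factorial : ZMod p) ^ n * (((m + k).choose m : ℕ) : ZMod p) ^ n := by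
    have h : (ascPochhammer (ZMod p) m).eval ((k + 1 : ℕ) : ZMod p) =
        (m.factorial : ZMod p) * (((m + k).choose m : ℕ) : ZMod p) := by
      rw [← ascPochhammer_eval_cast, ascPochhammer_nat_eq_ascFactorial,
        Nat.ascFactorial_eq_factorial_mul_choose, Nat.add_comm m k]
      push_cast
      rfl
    rw [← mul_pow, ← h]
    simp
  have hdeg : (((ascPochhammer (ZMod p) m).comp (Polynomial.X + 1)) ^ n).natDegree < p - 1 := by
    rw [Polynomial.natDegree_pow, Polynomial.natDegree_comp, ascPochhammer_natDegree,
      ← Polynomial.C_1, Polynomial.natDegree_X_add_C, mul_one, mul_comm]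
    exact hmn
  have hsum := FiniteField.sum_eval_eq_zero _ (hdeg.trans_eq (by rw [ZMod.card]))
  rw [ZMod.sum_eq_sum_range_natCast] at hsum
  simp_rw [heval, ← Finset.mul_sum] at hsum
  exact (mul_eq_zero.mp hsum).resolve_left (pow_ne_zero _ hfac)

/-- For integers `n > 2` and `q > 0` with `n` even or `q` odd, and any prime
`p > max {n, (q-1)n+1}`, one has `∑_{k=0}^{p-q} (q)_k^n / (1)_k^n ≡ 0 (mod p)`.
Each summand `(q)_k / (1)_k = C(q+k-1, k)` is a positive integer, so this is an ordinary
congruence between integers. -/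
theorem stmt_5 (n q : ℕ) (hn : 2 < n) (hq : 0 < q) (hpar : Even n ∨ Odd q)
    (p : ℕ) (hp : p.Prime) (hgt : p > max n ((q - 1) * n + 1)) :
    (p : ℤ) ∣ ∑ k ∈ Finset.range (p - q + 1), ((Nat.choose (q + k - 1) k : ℤ)) ^ n := by
  have : Fact p.Prime := ⟨hp⟩
  obtain ⟨m, rfl⟩ : ∃ m, q = m + 1 := ⟨q - 1, by omega⟩
  obtain ⟨-, hmn⟩ := max_lt_iff.mp hgt
  rw [Nat.add_sub_cancel] at hmn
  have hm : m + 1 < p := by nlinarith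
  have hterm (k : ℕ) : (m + 1 + k - 1).choose k = (m + k).choose m := by
    rw [show m + 1 + k - 1 = m + k by omega, ← Nat.choose_symm_add]
  simp_rw [hterm]
  rw [← ZMod.intCast_zmod_eq_zero_iff_dvd]
  push_cast
  rw [← ZMod.sum_range_choose_pow_eq_zero p m n (by omega) (by omega)]
  refine Finset.sum_subset (Finset.range_subset_range.mpr (by omega)) fun k hk hk' => ?_
  rw [Finset.mem_range] at hk hk'
  have hdvd : p ∣ (m + k).choose m :=
    hp.dvd_choose (by omega) (by omega) (by omega)
  rw [(ZMod.natCast_eq_zero_iff _ _).mpr hdvd, zero_pow (by omega)]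
end

section
/- Let n > 2 and q > 0 be integers such that n is even or q is odd, and let p be a prime with p > max{n, (q-1)n + 1}. Then the rational number ∑_{k=0}^{p-q} ((q)_k^n / (1)_k^n) · (H_{q+k-1}^{(2)} - H_k^{(2)}) is congruent to 0 modulo p, i.e., its p-adic valuation is at least 1. -/
/-- `H m k` is the `k`-th harmonic number of order `m`: `H_k^{(m)} = ∑_{j=1}^k 1/j^m`. -/
def harm (m k : ℕ) : ℚ := ∑ j ∈ Finset.range k, 1 / ((j : ℚ) + 1) ^ m

open Polynomial in
/-- A polynomial of degree less than `p - 1` sums to zero over a full residue system modulo `p`. -/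
theorem prime_dvd_sum_range_eval (p : ℕ) (hp : p.Prime) (R : ℤ[X]) (hR : R.natDegree < p - 1) :
    (p : ℤ) ∣ ∑ k ∈ Finset.range p, R.eval (k : ℤ) := by
  have : Fact p.Prime := ⟨hp⟩
  simp_rw [eval_eq_sum_range]
  rw [Finset.sum_comm]
  refine Finset.dvd_sum fun i hi => ?_
  rw [← Finset.mul_sum]
  refine Dvd.dvd.mul_left ?_ _
  rw [← ZMod.intCast_zmod_eq_zero_iff_dvd]
  push_cast
  have h : ∑ x : ZMod p, x ^ i = 0 := by
    refine FiniteField.sum_pow_lt_card_sub_one (ZMod p) i ?_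
    rw [ZMod.card]
    have := Finset.mem_range.1 hi
    omega
  rw [← h]
  refine Finset.sum_bij (fun k _ => (k : ZMod p)) (fun _ _ => Finset.mem_univ _) ?_ ?_
    (fun _ _ => rfl)
  · intro a ha b hb hab
    rw [Finset.mem_range] at ha hb
    have := congrArg ZMod.val hab
    rwa [ZMod.val_cast_of_lt ha, ZMod.val_cast_of_lt hb] at this
  · intro b _
    exact ⟨b.val, Finset.mem_range.2 b.val_lt, ZMod.natCast_zmod_val b⟩

open Polynomial in
/-- The polynomial `∑_{j=1}^m ((X+1)⋯(X+m))^n / (X+j)^2`. -/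
noncomputable def harmonicNumerator (n m : ℕ) : ℤ[X] :=
  ∑ j ∈ Finset.range m,
    (∏ i ∈ (Finset.range m).erase j, (X + C ((i : ℤ) + 1))) ^ n *
      (X + C ((j : ℤ) + 1)) ^ (n - 2)

open Polynomial in
theorem natDegree_harmonicNumerator_le (n m : ℕ) (hn : 2 ≤ n) :
    (harmonicNumerator n m).natDegree ≤ m * n - 2 := by
  refine natDegree_sum_le_of_forall_le _ _ fun j hj => ?_
  refine natDegree_mul_le.trans ?_
  have h₁ : (∏ i ∈ (Finset.range m).erase j, (X + C ((i : ℤ) + 1))).natDegree ≤ m - 1 := by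
    refine (natDegree_prod_le _ _).trans ?_
    simp only [natDegree_X_add_C, Finset.sum_const, smul_eq_mul, mul_one]
    rw [Finset.card_erase_of_mem hj, Finset.card_range]
  have h₂ := (natDegree_pow_le_of_le n h₁)
  have h₃ := natDegree_pow_le_of_le (n - 2) (natDegree_X_add_C ((j : ℤ) + 1)).le
  obtain ⟨m, rfl⟩ : ∃ a, m = a + 1 := ⟨m - 1, by have := Finset.mem_range.1 hj; omega⟩
  refine (add_le_add h₂ h₃).trans ?_
  rw [add_mul, Nat.add_sub_cancel, mul_comm n m]
  omega

theorem dvd_eval_harmonicNumerator (n m i k : ℕ) (hn : 2 < n) (hi : i < m) :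
    ((k : ℤ) + i + 1) ∣ (harmonicNumerator n m).eval (k : ℤ) := by
  rw [harmonicNumerator, Polynomial.eval_finsetSum]
  refine Finset.dvd_sum fun j _ => ?_
  simp only [Polynomial.eval_mul, Polynomial.eval_pow, Polynomial.eval_prod, Polynomial.eval_add,
    Polynomial.eval_X, Polynomial.eval_C]
  by_cases hij : i = j
  · subst hij
    rw [add_assoc]
    exact Dvd.dvd.mul_left (dvd_pow_self _ (by omega)) _
  · refine Dvd.dvd.mul_right (Dvd.dvd.trans ?_ (dvd_pow_self _ (by omega))) _
    rw [add_assoc]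
    exact Finset.dvd_prod_of_mem (fun i : ℕ => (k : ℤ) + ((i : ℤ) + 1))
      (Finset.mem_erase.2 ⟨hij, Finset.mem_range.2 hi⟩)

theorem prime_dvd_sum_range_sub_eval_harmonicNumerator (n m p : ℕ) (hp : p.Prime) (hn : 2 < n)
    (hm : m ≤ p) (hlt : m * n < p - 1) :
    (p : ℤ) ∣ ∑ k ∈ Finset.range (p - m), (harmonicNumerator n m).eval (k : ℤ) := by
  have h := prime_dvd_sum_range_eval p hp (harmonicNumerator n m)
    (by have := natDegree_harmonicNumerator_le n m hn.le; omega)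
  rw [← Finset.sum_range_add_sum_Ico _ (Nat.sub_le p m)] at h
  refine (dvd_add_left (Finset.dvd_sum fun k hk => ?_)).1 h
  rw [Finset.mem_Ico] at hk
  have hd := dvd_eval_harmonicNumerator n m (p - 1 - k) k hn (by omega)
  have he : (k : ℤ) + (p - 1 - k : ℕ) + 1 = p := by omega
  rwa [he] at hd

theorem ascPochhammer_eval_div_ascPochhammer_eval_one (m k : ℕ) :
    (ascPochhammer ℚ k).eval ((m + 1 : ℕ) : ℚ) / (ascPochhammer ℚ k).eval 1 =
      (∏ i ∈ Finset.range m, ((k : ℚ) + (i + 1))) / (m.factorial : ℚ) := by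
  have h₁ : ((m.factorial : ℚ)) * (ascPochhammer ℚ k).eval ((m + 1 : ℕ) : ℚ) =
      ((m + k).factorial : ℚ) := by
    rw [← ascPochhammer_eval_cast, ascPochhammer_nat_eq_ascFactorial,
      ← Nat.factorial_mul_ascFactorial]
    push_cast
    rfl
  have h₂ : (k.factorial : ℚ) * ∏ i ∈ Finset.range m, ((k : ℚ) + (i + 1)) =
      ((m + k).factorial : ℚ) := by
    rw [add_comm m k, ← Nat.factorial_mul_ascFactorial, Nat.ascFactorial_eq_prod_range]
    push_cast
    congr 1
    exact Finset.prod_congr rfl fun i _ => by ring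
  have hm : (m.factorial : ℚ) ≠ 0 := by exact_mod_cast m.factorial_ne_zero
  have hk : (k.factorial : ℚ) ≠ 0 := by exact_mod_cast k.factorial_ne_zero
  rw [ascPochhammer_eval_one, div_eq_div_iff hk hm, mul_comm, h₁, ← h₂, mul_comm]

theorem harm_add_sub_harm (r k m : ℕ) :
    harm r (m + k) - harm r k = ∑ j ∈ Finset.range m, 1 / ((k : ℚ) + (j + 1)) ^ r := by
  rw [harm, harm, add_comm m k, Finset.sum_range_add, add_sub_cancel_left]
  refine Finset.sum_congr rfl fun j _ => ?_
  push_cast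
  rw [add_assoc]

theorem prod_pow_mul_sum_eq_eval_harmonicNumerator (n m k : ℕ) (hn : 2 ≤ n) :
    (∏ i ∈ Finset.range m, ((k : ℚ) + (i + 1))) ^ n *
      ∑ j ∈ Finset.range m, 1 / ((k : ℚ) + (j + 1)) ^ 2 =
      ((harmonicNumerator n m).eval (k : ℤ) : ℤ) := by
  rw [harmonicNumerator, Polynomial.eval_finsetSum, Finset.mul_sum]
  push_cast
  refine Finset.sum_congr rfl fun j hj => ?_
  simp only [Polynomial.eval_mul, Polynomial.eval_pow, Polynomial.eval_prod, Polynomial.eval_add,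
    Polynomial.eval_X, Polynomial.eval_C]
  push_cast
  obtain ⟨n, rfl⟩ := Nat.exists_eq_add_of_le hn
  have hne : (k : ℚ) + (j + 1) ≠ 0 := by positivity
  rw [← Finset.mul_prod_erase _ _ hj, Nat.add_sub_cancel_left, mul_pow,
    pow_add ((k : ℚ) + (j + 1))]
  field_simp

/-- For integers `n > 2` and `q > 0` with `n` even or `q` odd, and any prime
`p > max {n, (q-1)n+1}`, the rational number
`∑_{k=0}^{p-q} ((q)_k^n / (1)_k^n) (H_{q+k-1}^{(2)} - H_k^{(2)})`
is congruent to `0` modulo `p`, i.e. it can be written as `p * a / b` with `p ∤ b`. -/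
theorem stmt_6 (n q : ℕ) (hn : 2 < n) (hq : 0 < q) (hpar : Even n ∨ Odd q)
    (p : ℕ) (hp : p.Prime) (hgt : p > max n ((q - 1) * n + 1)) :
    ∃ a b : ℤ, ¬ ((p : ℤ) ∣ b) ∧
      ∑ k ∈ Finset.range (p - q + 1),
          (((ascPochhammer ℚ k).eval (q : ℚ)) ^ n / ((ascPochhammer ℚ k).eval 1) ^ n) *
            (harm 2 (q + k - 1) - harm 2 k)
        = (p : ℚ) * a / b := by
  obtain ⟨m, rfl⟩ : ∃ m, q = m + 1 := ⟨q - 1, by omega⟩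
  rw [Nat.add_sub_cancel] at hgt
  have hlt : m * n + 1 < p := (le_max_right _ _).trans_lt hgt
  have hmn : m ≤ m * n := Nat.le_mul_of_pos_right m (by omega)
  have hrange : p - (m + 1) + 1 = p - m := by omega
  obtain ⟨a, ha⟩ := prime_dvd_sum_range_sub_eval_harmonicNumerator n m p hp hn
    (by omega) (by omega)
  refine ⟨a, (m.factorial : ℤ) ^ n, fun h => ?_, ?_⟩
  · have h' : p ∣ m.factorial ^ n := by exact_mod_cast h
    have := hp.dvd_factorial.1 (hp.dvd_of_dvd_pow h')
    omega
  · have ha' : ((∑ k ∈ Finset.range (p - m), (harmonicNumerator n m).eval (k : ℤ) : ℤ) : ℚ) =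
        (p : ℚ) * a := by rw [ha]; push_cast; rfl
    rw [← ha', hrange]
    push_cast
    rw [Finset.sum_div]
    refine Finset.sum_congr rfl fun k _ => ?_
    rw [show m + 1 + k - 1 = m + k by omega, ← div_pow,
      ← Nat.cast_add_one, ascPochhammer_eval_div_ascPochhammer_eval_one, harm_add_sub_harm,
      ← prod_pow_mul_sum_eq_eval_harmonicNumerator n m k hn.le, div_pow, div_mul_eq_mul_div]
end

section
/- Let n > 2 and q > 0 be integers such that n is even or q is odd, and let p be a prime with p > max{n, (q-1)n + 1}. Then the rational number ∑_{k=0}^{p-q} ((q)_k^n / (1)_k^n) · H_{q+k-1}^{(2)} is congruent to 0 modulo p, i.e., its p-adic valuation is at least 1. -/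
open Finset Polynomial

/-- A polynomial of degree less than `p - 1` sums to zero over `ZMod p`. -/
lemma sum_eval_eq_zero_of_natDegree_lt_s7 {p : ℕ} [Fact p.Prime] (f : (ZMod p)[X])
    (hf : f.natDegree < p - 1) : ∑ x : ZMod p, f.eval x = 0 := by
  simp_rw [eval_eq_sum_range]
  rw [sum_comm]
  refine sum_eq_zero fun i hi => ?_
  rw [← mul_sum, FiniteField.sum_pow_lt_card_sub_one, mul_zero]
  rw [ZMod.card]
  have := mem_range.1 hi
  omega

lemma sum_inv_sq_eq_zero {p : ℕ} [Fact p.Prime] (hp : 3 < p) :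
    ∑ x : ZMod p, (x ^ 2)⁻¹ = 0 := by
  have h := FiniteField.sum_pow_lt_card_sub_one (K := ZMod p) 2 (by rw [ZMod.card]; omega)
  rw [← h]
  exact Fintype.sum_bijective _ (inv_involutive (G := ZMod p)).bijective _ _ fun x => (inv_pow x 2).symm

/-- The harmonic numbers of order two modulo `p`, as a function of the residue of the index. -/
def harmZMod (p : ℕ) (x : ZMod p) : ZMod p :=
  ∑ j ∈ range x.val, (((j : ZMod p) + 1) ^ 2)⁻¹

lemma harmZMod_natCast {p : ℕ} {j : ℕ} (hj : j < p) :
    harmZMod p (j : ZMod p) = ∑ i ∈ range j, (((i : ZMod p) + 1) ^ 2)⁻¹ := by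
  rw [harmZMod, ZMod.val_natCast_of_lt hj]

lemma sum_zmod_eq_sum_range {p : ℕ} [NeZero p] (f : ZMod p → ZMod p) :
    ∑ x : ZMod p, f x = ∑ j ∈ range p, f j := by
  symm
  refine sum_bij (fun j _ => (j : ZMod p)) (fun _ _ => mem_univ _) ?_ ?_ (fun _ _ => rfl)
  · intro a ha b hb h
    rw [← ZMod.val_natCast_of_lt (mem_range.1 ha), h, ZMod.val_natCast_of_lt (mem_range.1 hb)]
  · intro x _
    exact ⟨x.val, mem_range.2 (ZMod.val_lt x), ZMod.natCast_zmod_val x⟩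

lemma harmZMod_add_one {p : ℕ} [Fact p.Prime] (hp : 3 < p) (x : ZMod p) :
    harmZMod p (x + 1) = harmZMod p x + ((x + 1) ^ 2)⁻¹ := by
  obtain ⟨j, hj, rfl⟩ : ∃ j < p, (j : ZMod p) = x :=
    ⟨x.val, ZMod.val_lt x, ZMod.natCast_zmod_val x⟩
  rcases (Nat.succ_le_of_lt hj).lt_or_eq with h | h
  · have := harmZMod_natCast h
    rw [Nat.succ_eq_add_one, sum_range_succ, ← harmZMod_natCast hj] at this
    exact_mod_cast this
  · have h0 : (j : ZMod p) + 1 = 0 := by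
      rw [← Nat.cast_add_one, ← Nat.succ_eq_add_one, h, ZMod.natCast_self]
    have hs := sum_inv_sq_eq_zero hp
    rw [sum_zmod_eq_sum_range, show range p = range (j + 1) from congrArg range h.symm,
      sum_range_succ'] at hs
    simp only [Nat.cast_add, Nat.cast_one, Nat.cast_zero] at hs
    rw [h0, harmZMod_natCast hj]
    simpa [harmZMod] using hs.symm

lemma harmZMod_neg_one_sub {p : ℕ} [Fact p.Prime] (hp : 3 < p) (x : ZMod p) :
    harmZMod p (-1 - x) = -harmZMod p x := by
  have key : ∀ j : ℕ, harmZMod p (-1 - (j : ZMod p)) = -harmZMod p (j : ZMod p) := by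
    intro j
    induction j with
    | zero =>
      have h := harmZMod_add_one hp (-1)
      simp [harmZMod] at h ⊢
      exact h.symm
    | succ j ih =>
      have h1 := harmZMod_add_one hp (j : ZMod p)
      have h2 := harmZMod_add_one hp (-1 - ((j : ZMod p) + 1))
      rw [show -1 - ((j : ZMod p) + 1) + 1 = -1 - j by ring, ih,
        show (-1 - (j : ZMod p)) ^ 2 = (j + 1) ^ 2 by ring] at h2
      push_cast
      rw [h1]
      linear_combination -h2
  simpa using key x.val

lemma harmZMod_sub_natCast {p : ℕ} [Fact p.Prime] (hp : 3 < p) (x : ZMod p) (m : ℕ) :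
    harmZMod p (x - m) = harmZMod p x - ∑ i ∈ range m, ((x - i) ^ 2)⁻¹ := by
  induction m with
  | zero => simp
  | succ m ih =>
    have h := harmZMod_add_one hp (x - ((m : ZMod p) + 1))
    rw [show x - ((m : ZMod p) + 1) + 1 = x - m by ring, ih] at h
    rw [sum_range_succ]
    push_cast
    linear_combination -h

/-- The falling factorial, raised to a power `n ≥ 3` and divided by the square of one of its linear
factors, sums to zero over `ZMod p`. -/
lemma sum_prod_pow_mul_inv_sq {p : ℕ} [Fact p.Prime] {n m : ℕ} (hn : 2 < n) (hm : m * n + 1 < p)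
    {i : ℕ} (hi : i ∈ range m) :
    ∑ x : ZMod p, (∏ j ∈ range m, (x - j)) ^ n * ((x - i) ^ 2)⁻¹ = 0 := by
  let f : (ZMod p)[X] :=
    (∏ j ∈ (range m).erase i, (X - C (j : ZMod p))) ^ n * (X - C (i : ZMod p)) ^ (n - 2)
  have hdeg : f.natDegree < p - 1 := by
    have h1 : f.natDegree ≤ n * (m - 1) + (n - 2) * 1 := by
      refine natDegree_mul_le.trans (add_le_add ?_ ?_)
      · refine natDegree_pow_le.trans (Nat.mul_le_mul_left _ ?_)
        refine (natDegree_prod_le _ _).trans ?_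
        simp only [natDegree_X_sub_C, sum_const, card_erase_of_mem hi,
          card_range, smul_eq_mul, mul_one, le_refl]
      · refine natDegree_pow_le.trans (Nat.mul_le_mul_left _ (natDegree_X_sub_C_le _))
    obtain ⟨m, rfl⟩ : ∃ k, m = k + 1 :=
      ⟨m - 1, by have := mem_range.1 hi; omega⟩
    rw [Nat.add_sub_cancel, mul_one, mul_comm] at h1
    rw [add_mul] at hm
    omega
  rw [← sum_eval_eq_zero_of_natDegree_lt_s7 f hdeg]
  refine sum_congr rfl fun x _ => ?_
  simp only [f, eval_mul, eval_pow, eval_prod, eval_sub, eval_X, eval_C]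
  rw [← mul_prod_erase _ _ hi, mul_pow]
  by_cases hx : x - (i : ZMod p) = 0
  · rw [hx, zero_pow (by omega), zero_pow (by omega : n - 2 ≠ 0)]
    simp
  · obtain ⟨k, rfl⟩ := Nat.exists_eq_add_of_lt hn
    rw [show 2 + k + 1 - 2 = k + 1 by omega]
    field_simp
    ring

lemma prod_range_sub_reflect {R : Type*} [CommRing R] (m : ℕ) (x : R) :
    ∏ j ∈ range m, ((m : R) - 1 - x - j) = (-1) ^ m * ∏ j ∈ range m, (x - j) := by
  rw [← prod_range_reflect (fun j => (m : R) - 1 - x - j)]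
  have h : (-1 : R) ^ m = ∏ _j ∈ range m, (-1 : R) := by rw [prod_const, card_range]
  rw [h, ← prod_mul_distrib]
  refine prod_congr rfl fun j hj => ?_
  have := mem_range.1 hj
  rw [Nat.cast_sub (by omega), Nat.cast_sub (by omega)]
  push_cast
  ring

lemma sum_prod_pow_mul_harmZMod {p : ℕ} [Fact p.Prime] {n m : ℕ} (hn : 2 < n) (hp : 3 < p)
    (hm : m * n + 1 < p) (hpar : Even (m * n)) :
    ∑ x : ZMod p, (∏ j ∈ range m, (x - j)) ^ n * harmZMod p x = 0 := by
  set S := ∑ x : ZMod p, (∏ j ∈ range m, (x - j)) ^ n * harmZMod p x with hS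
  have hrefl : S = ∑ x : ZMod p, (∏ j ∈ range m, (x - j)) ^ n * -harmZMod p (x - m) := by
    rw [hS]
    refine Fintype.sum_equiv (Equiv.subLeft ((m : ZMod p) - 1)) _ _ fun x => ?_
    rw [Equiv.subLeft_apply, prod_range_sub_reflect, mul_pow, ← pow_mul, hpar.neg_one_pow, one_mul,
      show (m : ZMod p) - 1 - x - m = -1 - x by ring, harmZMod_neg_one_sub hp, neg_neg]
  have h2 : S = -S := by
    conv_lhs => rw [hrefl]
    simp_rw [harmZMod_sub_natCast hp, neg_sub, mul_sub, mul_sum]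
    rw [sum_sub_distrib, sum_comm, sum_eq_zero fun i hi => sum_prod_pow_mul_inv_sq hn hm hi,
      zero_sub]
  have : (2 : ZMod p) ≠ 0 := by
    intro h
    have h' : ((2 : ℕ) : ZMod p) = 0 := by exact_mod_cast h
    rw [ZMod.natCast_eq_zero_iff] at h'
    have := Nat.le_of_dvd (by norm_num) h'
    omega
  have h3 : 2 * S = 0 := by linear_combination h2
  exact (mul_eq_zero.1 h3).resolve_left this

lemma sum_choose_pow_mul_harmZMod {p : ℕ} [Fact p.Prime] {n m : ℕ} (hn : 2 < n) (hp : 3 < p)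
    (hm : m * n + 1 < p) (hpar : Even (m * n)) :
    ∑ j ∈ range p, (j.choose m : ZMod p) ^ n * harmZMod p j = 0 := by
  have hfac : (m.factorial : ZMod p) ^ n ≠ 0 := by
    refine pow_ne_zero _ ?_
    rw [Ne, ZMod.natCast_eq_zero_iff, (Fact.out : p.Prime).dvd_factorial]
    nlinarith
  refine (mul_eq_zero.1 ?_).resolve_left hfac
  rw [← sum_prod_pow_mul_harmZMod hn hp hm hpar, sum_zmod_eq_sum_range, mul_sum]
  refine sum_congr rfl fun j _ => ?_
  rw [← mul_assoc, ← mul_pow, ← Nat.cast_mul, ← Nat.descFactorial_eq_factorial_mul_choose]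
  congr 2
  rw [← descPochhammer_eval_eq_descFactorial, descPochhammer_eval_eq_prod_range]

/-- `ReducesTo p x y` says that the rational `x` is `p`-integral with residue `y` modulo `p`. -/
def ReducesTo (p : ℕ) (x : ℚ) (y : ZMod p) : Prop :=
  ∃ a b : ℤ, ¬ (p : ℤ) ∣ b ∧ x = a / b ∧ (a : ZMod p) = y * b

namespace ReducesTo

variable {p : ℕ} {x x' : ℚ} {y y' : ZMod p}

lemma ne_zero_of_not_dvd {b : ℤ} (hb : ¬ (p : ℤ) ∣ b) : (b : ℚ) ≠ 0 := by
  rintro h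
  exact hb (by simp [Int.cast_eq_zero.1 h])

variable [Fact p.Prime]

lemma natCast (n : ℕ) : ReducesTo p n n :=
  ⟨n, 1, fun h => (Fact.out : p.Prime).one_lt.not_ge
    (Nat.le_of_dvd one_pos (by exact_mod_cast h)), by simp, by simp⟩

lemma not_dvd_mul {b b' : ℤ} (hb : ¬ (p : ℤ) ∣ b) (hb' : ¬ (p : ℤ) ∣ b') :
    ¬ (p : ℤ) ∣ b * b' := fun h =>
  ((Nat.prime_iff_prime_int.1 Fact.out).dvd_or_dvd h).elim hb hb'

lemma add (h : ReducesTo p x y) (h' : ReducesTo p x' y') : ReducesTo p (x + x') (y + y') := by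
  obtain ⟨a, b, hb, rfl, ha⟩ := h
  obtain ⟨a', b', hb', rfl, ha'⟩ := h'
  refine ⟨a * b' + b * a', b * b', not_dvd_mul hb hb', ?_, ?_⟩
  · have := ne_zero_of_not_dvd hb
    have := ne_zero_of_not_dvd hb'
    push_cast
    field_simp
  · push_cast
    rw [ha, ha']
    ring

lemma mul (h : ReducesTo p x y) (h' : ReducesTo p x' y') : ReducesTo p (x * x') (y * y') := by
  obtain ⟨a, b, hb, rfl, ha⟩ := h
  obtain ⟨a', b', hb', rfl, ha'⟩ := h'
  refine ⟨a * a', b * b', not_dvd_mul hb hb', ?_, ?_⟩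
  · push_cast
    rw [div_mul_div_comm]
  · push_cast
    rw [ha, ha']
    ring

lemma one_div_natCast {n : ℕ} (hn : ¬ p ∣ n) : ReducesTo p (1 / (n : ℚ)) (n : ZMod p)⁻¹ := by
  refine ⟨1, n, by exact_mod_cast hn, by simp, ?_⟩
  have : (n : ZMod p) ≠ 0 := by rwa [Ne, ZMod.natCast_eq_zero_iff]
  simp [this]

lemma sum {ι : Type*} {s : Finset ι} {f : ι → ℚ} {g : ι → ZMod p}
    (h : ∀ i ∈ s, ReducesTo p (f i) (g i)) : ReducesTo p (∑ i ∈ s, f i) (∑ i ∈ s, g i) := by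
  classical
  induction s using Finset.induction_on with
  | empty => simpa using natCast (p := p) 0
  | insert i s hi ih =>
    rw [sum_insert hi, sum_insert hi]
    exact (h i (mem_insert_self _ _)).add (ih fun j hj => h j (mem_insert_of_mem hj))

lemma harm_two {k : ℕ} (hk : k < p) : ReducesTo p (harm 2 k) (harmZMod p k) := by
  rw [harmZMod_natCast hk]
  refine sum fun j hj => ?_
  have hj' := mem_range.1 hj
  have h : ¬ p ∣ (j + 1) ^ 2 := fun h => by
    have := Nat.le_of_dvd j.succ_pos ((Fact.out : p.Prime).dvd_of_dvd_pow h)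
    omega
  exact_mod_cast one_div_natCast h

end ReducesTo

lemma ascPochhammer_eval_div (m k : ℕ) :
    (ascPochhammer ℚ k).eval ((m + 1 : ℕ) : ℚ) / (ascPochhammer ℚ k).eval 1 =
      ((m + k).choose m : ℚ) := by
  rw [ascPochhammer_eval_one, ← ascPochhammer_eval_cast, ascPochhammer_nat_eq_ascFactorial,
    Nat.ascFactorial_eq_factorial_mul_choose, ← Nat.choose_symm_add]
  have : (k.factorial : ℚ) ≠ 0 := by exact_mod_cast k.factorial_ne_zero
  push_cast
  field_simp

/-- For integers `n > 2` and `q > 0` with `n` even or `q` odd, and any prime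
`p > max {n, (q-1)n+1}`, the rational number
`∑_{k=0}^{p-q} ((q)_k^n / (1)_k^n) H_{q+k-1}^{(2)}`
is congruent to `0` modulo `p`, i.e. it can be written as `p * a / b` with `p ∤ b`. -/
theorem stmt_7 (n q : ℕ) (hn : 2 < n) (hq : 0 < q) (hpar : Even n ∨ Odd q)
    (p : ℕ) (hp : p.Prime) (hgt : p > max n ((q - 1) * n + 1)) :
    ∃ a b : ℤ, ¬ ((p : ℤ) ∣ b) ∧
      ∑ k ∈ Finset.range (p - q + 1),
          (((ascPochhammer ℚ k).eval (q : ℚ)) ^ n / ((ascPochhammer ℚ k).eval 1) ^ n) *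
            harm 2 (q + k - 1)
        = (p : ℚ) * a / b := by
  have : Fact p.Prime := ⟨hp⟩
  obtain ⟨m, rfl⟩ : ∃ m, q = m + 1 := ⟨q - 1, by omega⟩
  rw [Nat.add_sub_cancel] at hgt
  obtain ⟨hpn, hm⟩ := max_lt_iff.1 hgt
  have hmp : m < p := by nlinarith
  have hev : Even (m * n) := by
    rcases hpar with h | h
    · exact h.mul_left m
    · exact Even.mul_right (by simpa [parity_simps] using h) n
  have hred : ReducesTo p (∑ k ∈ range (p - (m + 1) + 1),
      (((ascPochhammer ℚ k).eval ((m + 1 : ℕ) : ℚ)) ^ n / ((ascPochhammer ℚ k).eval 1) ^ n) *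
        harm 2 (m + 1 + k - 1))
      (∑ k ∈ range (p - (m + 1) + 1),
        ((m + k).choose m : ZMod p) ^ n * harmZMod p ((m + k : ℕ) : ZMod p)) := by
    refine ReducesTo.sum fun k hk => ?_
    have hk' := mem_range.1 hk
    rw [← div_pow, ascPochhammer_eval_div, show m + 1 + k - 1 = m + k by omega]
    refine ReducesTo.mul ?_ (ReducesTo.harm_two (by omega))
    exact_mod_cast ReducesTo.natCast (p := p) ((m + k).choose m ^ n)
  have hzero : ∑ k ∈ range (p - (m + 1) + 1),
      ((m + k).choose m : ZMod p) ^ n * harmZMod p ((m + k : ℕ) : ZMod p) = 0 := by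
    have h := sum_choose_pow_mul_harmZMod (p := p) hn (by omega) hm hev
    have hr : range p = range (m + (p - (m + 1) + 1)) := congrArg range (by omega)
    rw [hr, sum_range_add] at h
    rwa [sum_eq_zero, zero_add] at h
    intro j hj
    rw [Nat.choose_eq_zero_of_lt (mem_range.1 hj), Nat.cast_zero, zero_pow (by omega), zero_mul]
  rw [hzero] at hred
  obtain ⟨a, b, hb, hab, ha⟩ := hred
  rw [zero_mul, ZMod.intCast_zmod_eq_zero_iff_dvd] at ha
  obtain ⟨c, rfl⟩ := ha
  exact ⟨c, b, hb, by rw [hab]; push_cast; rfl⟩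
end

section
/- Let n > 2 and q > 0 be integers such that n is even or q is odd, and let p be a prime with p > max{n, (q-1)n + 1}. Then ∑_{k=0}^{p-q} ((q)_k^n / (1)_k^n) · H_k^{(2)} ≡ ∑_{k=0}^{p-q} ((q)_k^n / (1)_k^n) · H_{p-q-k}^{(2)} (mod p), i.e., the p-adic valuation of the difference of these two rational numbers is at least 1. -/
/-- Reflection of binomial coefficients modulo a prime `p`. -/
theorem choose_reflect_zmod {p : ℕ} (hp : p.Prime) {q k : ℕ} (hq : 0 < q) (hqp : q ≤ p)
    (hk : k ≤ p - q) :
    (((q + (p - q - k) - 1).choose (p - q - k) : ℕ) : ZMod p)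
      = (-1) ^ (q - 1) * ((q + k - 1).choose k : ℕ) := by
  have := Fact.mk hp
  obtain ⟨r, rfl⟩ : ∃ r, q = r + 1 := ⟨q - 1, by omega⟩
  have hfac : ((r.factorial : ℕ) : ZMod p) ≠ 0 := by
    rw [Ne, ZMod.natCast_eq_zero_iff, hp.dvd_factorial]
    omega
  have hleft : (r + 1 + (p - (r + 1) - k) - 1).choose (p - (r + 1) - k)
      = (p - 1 - k).choose r := by
    rw [← Nat.choose_symm (show r ≤ p - 1 - k by omega)]
    congr 1 <;> omega
  have hright : (r + 1 + k - 1).choose k = (k + r).choose r := by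
    rw [show r + 1 + k - 1 = k + r by omega, Nat.choose_symm_add]
  have hcast : ((p - 1 - k : ℕ) : ZMod p) = -((k + 1 : ℕ) : ZMod p) := by
    rw [eq_neg_iff_add_eq_zero, ← Nat.cast_add, show p - 1 - k + (k + 1) = p by omega]
    simp
  rw [hleft, hright, Nat.add_sub_cancel]
  apply mul_left_cancel₀ hfac
  rw [mul_left_comm, ← Nat.cast_mul, ← Nat.cast_mul, ← Nat.descFactorial_eq_factorial_mul_choose,
    ← Nat.ascFactorial_eq_factorial_mul_choose, ← descPochhammer_eval_eq_descFactorial, hcast,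
    Nat.cast_ascFactorial]
  have h := ascPochhammer_eval_neg_eq_descPochhammer (ZMod p) (-((k + 1 : ℕ) : ZMod p)) r
  rw [neg_neg] at h
  rw [h, ← mul_assoc, ← mul_pow, neg_one_mul, neg_neg, one_pow, one_mul]

/-- The ratio of rising factorials `(q)_k / (1)_k` is a binomial coefficient. -/
theorem ascPochhammer_eval_div_eval_one (q k : ℕ) :
    (ascPochhammer ℚ k).eval (q : ℚ) / (ascPochhammer ℚ k).eval 1
      = ((q + k - 1).choose k : ℕ) := by
  rw [← Nat.cast_ascFactorial, ← Nat.cast_factorial, Nat.ascFactorial_eq_factorial_mul_choose',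
    Nat.cast_mul, mul_div_cancel_left₀]
  exact_mod_cast k.factorial_ne_zero

/-- Adding two fractions with denominators prime to `p` and numerators divisible by `m`. -/
theorem exists_mul_div_add {p : ℕ} (hp : p.Prime) (m : ℤ) {x y : ℚ}
    (hx : ∃ a b : ℤ, ¬ ((p : ℤ) ∣ b) ∧ x = (m : ℚ) * a / b)
    (hy : ∃ a b : ℤ, ¬ ((p : ℤ) ∣ b) ∧ y = (m : ℚ) * a / b) :
    ∃ a b : ℤ, ¬ ((p : ℤ) ∣ b) ∧ x + y = (m : ℚ) * a / b := by
  obtain ⟨a, b, hb, rfl⟩ := hx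
  obtain ⟨c, d, hd, rfl⟩ := hy
  have hb0 : (b : ℚ) ≠ 0 := by rintro h; exact hb (by simp_all)
  have hd0 : (d : ℚ) ≠ 0 := by rintro h; exact hd (by simp_all)
  refine ⟨a * d + c * b, b * d, ?_, ?_⟩
  · rw [(Nat.prime_iff_prime_int.mp hp).dvd_mul]
    tauto
  · push_cast
    field_simp

/-- Finite sums of fractions with denominators prime to `p` and numerators divisible by `m`. -/
theorem exists_mul_div_sum {p : ℕ} (hp : p.Prime) (m : ℤ) {ι : Type*} (s : Finset ι) (f : ι → ℚ)
    (hf : ∀ i ∈ s, ∃ a b : ℤ, ¬ ((p : ℤ) ∣ b) ∧ f i = (m : ℚ) * a / b) :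
    ∃ a b : ℤ, ¬ ((p : ℤ) ∣ b) ∧ ∑ i ∈ s, f i = (m : ℚ) * a / b :=
  Finset.sum_induction f (fun x ↦ ∃ a b : ℤ, ¬ ((p : ℤ) ∣ b) ∧ x = (m : ℚ) * a / b)
    (fun _ _ ↦ exists_mul_div_add hp m)
    ⟨0, 1, fun h ↦ (Nat.prime_iff_prime_int.mp hp).not_isUnit (isUnit_of_dvd_one h), by simp⟩ hf

/-- Harmonic numbers of index less than `p` are `p`-integral. -/
theorem exists_harm_eq_div {p : ℕ} (hp : p.Prime) (m : ℕ) {k : ℕ} (hk : k < p) :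
    ∃ a b : ℤ, ¬ ((p : ℤ) ∣ b) ∧ harm m k = (a : ℚ) / b := by
  have h := exists_mul_div_sum hp 1 (Finset.range k) (fun j ↦ 1 / ((j : ℚ) + 1) ^ m) ?_
  · simpa [harm] using h
  · intro j hj
    refine ⟨1, ((j + 1 : ℕ) : ℤ) ^ m, fun h ↦ ?_, by push_cast; simp⟩
    have h' := Int.natCast_dvd_natCast.mp ((Nat.prime_iff_prime_int.mp hp).dvd_of_dvd_pow h)
    have := Nat.le_of_dvd (by omega) h'
    have := Finset.mem_range.mp hj
    omega

/-- For integers `n > 2` and `q > 0` with `n` even or `q` odd, and any prime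
`p > max {n, (q-1)n+1}`,
`∑_{k=0}^{p-q} ((q)_k^n / (1)_k^n) H_k^{(2)} ≡ ∑_{k=0}^{p-q} ((q)_k^n / (1)_k^n) H_{p-q-k}^{(2)}
(mod p)`, i.e. the difference can be written as `p * a / b` with `p ∤ b`. -/
theorem stmt_9 (n q : ℕ) (hn : 2 < n) (hq : 0 < q) (hpar : Even n ∨ Odd q)
    (p : ℕ) (hp : p.Prime) (hgt : p > max n ((q - 1) * n + 1)) :
    ∃ a b : ℤ, ¬ ((p : ℤ) ∣ b) ∧
      (∑ k ∈ Finset.range (p - q + 1),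
          (((ascPochhammer ℚ k).eval (q : ℚ)) ^ n / ((ascPochhammer ℚ k).eval 1) ^ n) *
            harm 2 k)
        - (∑ k ∈ Finset.range (p - q + 1),
            (((ascPochhammer ℚ k).eval (q : ℚ)) ^ n / ((ascPochhammer ℚ k).eval 1) ^ n) *
              harm 2 (p - q - k))
        = (p : ℚ) * a / b := by
  have hqp : q ≤ p := by
    have h : (q - 1) * n + 1 < p := lt_of_le_of_lt (le_max_right _ _) hgt
    have := Nat.mul_le_mul_left (q - 1) (show 1 ≤ n by omega)
    omega
  simp only [← div_pow, ascPochhammer_eval_div_eval_one]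
  rw [← Finset.sum_range_reflect, ← Finset.sum_sub_distrib]
  refine exists_mul_div_sum hp p _ _ fun k hk ↦ ?_
  have hk' : k ≤ p - q := by simpa [Nat.lt_succ_iff] using hk
  obtain ⟨c, b, hb, hc⟩ := exists_harm_eq_div hp 2 (show p - q - k < p by omega)
  have hsign : ((-1 : ZMod p) ^ (q - 1)) ^ n = 1 := by
    rw [← pow_mul]
    refine Even.neg_one_pow ?_
    rcases hpar with h | h
    · exact h.mul_left _
    · exact (Nat.Odd.sub_odd h odd_one).mul_right _
  have hdvd : (p : ℤ) ∣ (((q + (p - q - k) - 1).choose (p - q - k) : ℕ) : ℤ) ^ n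
      - (((q + k - 1).choose k : ℕ) : ℤ) ^ n := by
    rw [← ZMod.intCast_zmod_eq_zero_iff_dvd _ p]
    push_cast
    rw [choose_reflect_zmod hp hq hqp hk', mul_pow, hsign, one_mul, sub_self]
  obtain ⟨a, ha⟩ := hdvd
  refine ⟨a * c, b, hb, ?_⟩
  have ha' : (((q + (p - q - k) - 1).choose (p - q - k) : ℕ) : ℚ) ^ n
      - (((q + k - 1).choose k : ℕ) : ℚ) ^ n = p * a := by exact_mod_cast ha
  rw [show p - q + 1 - 1 - k = p - q - k by omega, ← sub_mul, ha', hc]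
  push_cast
  ring
end
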